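/- arXiv:2510.20094 — 4 statements merged into one kernel-verified Lean document; each statement's English description precedes it below -/
import Mathlib

section
/- Assume sup_{ℓ≥1} ℓ|a_ℓ| < ∞. Let κ > 0 and let p : ℝ → ℝ be a 2π-periodic, even, continuously differentiable function with p ≥ 0 and (1/2π)∫₀^{2π} p(θ)dθ = 1, with Fourier cosine coefficients p_ℓ := (1/2π)∫₀^{2π} p(θ)cos(ℓθ)dθ, and set G(θ) := ∑_{ℓ≥1} a_ℓ p_ℓ cos(ℓθ) (this series and its term-wise derivative converge absolutely and uniformly, and G equals the convolution W⋆p). Then the following are equivalent: (i) p′(θ) = κ G′(θ) p(θ) for all θ ∈ ℝ; (ii) for every ℓ ≥ 1, ℓ(2 − κ a_ℓ) p_ℓ = κ ∑_{j=1}^{ℓ−1} j a_j p_j p_{ℓ−j} + κ ∑_{j=ℓ+1}^{∞} (j a_j − (j−ℓ) a_{j−ℓ}) p_j p_{j−ℓ}, all series converging absolutely. Moreover, if (i) holds then p is strictly positive and p(θ) = e^{κG(θ)}/Z for all θ, where Z := (1/2π)∫₀^{2π} e^{κG(ψ)} dψ. -/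
open scoped BigOperators
open Filter Topology Real

noncomputable section

/-- `x` solves the stationary Fourier system at intensity `κ` for coefficients `a`:
for every `ℓ ≥ 1` the tail series converges absolutely (equivalently, is `Summable` in `ℝ`) and
`ℓ(2 − κ a_ℓ) x_ℓ = κ ∑_{j=1}^{ℓ−1} j a_j x_j x_{ℓ−j}
  + κ ∑_{j=ℓ+1}^∞ (j a_j − (j−ℓ) a_{j−ℓ}) x_j x_{j−ℓ}`,
where the infinite sum is indexed by `j = ℓ + k + 1`, `k : ℕ`. -/
def SolvesMV (a : ℕ → ℝ) (κ : ℝ) (x : ℕ → ℝ) : Prop :=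
  ∀ ℓ : ℕ, 1 ≤ ℓ →
    Summable (fun k : ℕ =>
      (((ℓ + k + 1 : ℕ) : ℝ) * a (ℓ + k + 1) - ((k + 1 : ℕ) : ℝ) * a (k + 1))
        * x (ℓ + k + 1) * x (k + 1)) ∧
    (ℓ : ℝ) * (2 - κ * a ℓ) * x ℓ
      = κ * ∑ j ∈ Finset.Ico 1 ℓ, (j : ℝ) * a j * x j * x (ℓ - j)
        + κ * ∑' k : ℕ,
            (((ℓ + k + 1 : ℕ) : ℝ) * a (ℓ + k + 1) - ((k + 1 : ℕ) : ℝ) * a (k + 1))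
              * x (ℓ + k + 1) * x (k + 1)

/-- The squared weighted norm `∑_{ℓ≥1} (1+ℓ²) x_ℓ²`. -/
def wnormSq (x : ℕ → ℝ) : ℝ := ∑' ℓ : ℕ, (1 + ((ℓ + 1 : ℕ) : ℝ) ^ 2) * x (ℓ + 1) ^ 2

/-- The weighted norm `‖x‖_w = (∑_{ℓ≥1} (1+ℓ²) x_ℓ²)^{1/2}`. -/
def wnorm (x : ℕ → ℝ) : ℝ := Real.sqrt (wnormSq x)

/-- Membership in the weighted space `ℓ²_w`. -/
def MemL2w (x : ℕ → ℝ) : Prop :=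
  Summable fun ℓ : ℕ => (1 + ((ℓ + 1 : ℕ) : ℝ) ^ 2) * x (ℓ + 1) ^ 2

/-- The `ℓ`-th Fourier cosine coefficient `p_ℓ = (1/2π)∫₀^{2π} p(θ) cos(ℓθ) dθ`. -/
def fourierCoef (p : ℝ → ℝ) (ℓ : ℕ) : ℝ :=
  (1 / (2 * π)) * ∫ θ in (0:ℝ)..(2 * π), p θ * Real.cos ((ℓ : ℝ) * θ)

/-- `G(θ) = ∑_{ℓ≥1} a_ℓ p_ℓ cos(ℓθ)` (the convolution `W⋆p`). -/
def Gfun (a : ℕ → ℝ) (p : ℝ → ℝ) (θ : ℝ) : ℝ :=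
  ∑' ℓ : ℕ, a (ℓ + 1) * fourierCoef p (ℓ + 1) * Real.cos (((ℓ + 1 : ℕ) : ℝ) * θ)

/-- The term-wise derivative of `G`. -/
def Gderiv (a : ℕ → ℝ) (p : ℝ → ℝ) (θ : ℝ) : ℝ :=
  ∑' ℓ : ℕ, -(a (ℓ + 1) * fourierCoef p (ℓ + 1) * ((ℓ + 1 : ℕ) : ℝ)
      * Real.sin (((ℓ + 1 : ℕ) : ℝ) * θ))

/-- The normalizing constant `Z = (1/2π)∫₀^{2π} e^{κ G(ψ)} dψ`. -/
def Zconst (a : ℕ → ℝ) (κ : ℝ) (p : ℝ → ℝ) : ℝ :=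
  (1 / (2 * π)) * ∫ ψ in (0:ℝ)..(2 * π), Real.exp (κ * Gfun a p ψ)

instance factTwoPi : Fact (0 < 2 * π) := ⟨Real.two_pi_pos⟩

/-- Lift of a continuous periodic real function to the circle. -/
def liftC (f : ℝ → ℝ) (hf : Continuous f) (hp : Function.Periodic f (2 * π)) :
    C(AddCircle (2 * π), ℂ) where
  toFun := Function.Periodic.lift (f := fun x => (f x : ℂ)) (c := 2 * π)
    (fun x => by simp only [hp x])
  continuous_toFun := by
    apply continuous_coinduced_dom.mpr
    exact (Complex.continuous_ofReal.comp hf)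

lemma liftC_coe (f : ℝ → ℝ) (hf : Continuous f) (hp : Function.Periodic f (2 * π)) (x : ℝ) :
    liftC f hf hp (x : AddCircle (2 * π)) = (f x : ℂ) := rfl

lemma coeff_liftC (f : ℝ → ℝ) (hf : Continuous f) (hp : Function.Periodic f (2 * π)) (n : ℤ) :
    fourierCoeff (liftC f hf hp) n =
      (((1 / (2 * π)) * ∫ x in (0:ℝ)..(2 * π), f x * Real.cos (n * x) : ℝ) : ℂ)
      - (((1 / (2 * π)) * ∫ x in (0:ℝ)..(2 * π), f x * Real.sin (n * x) : ℝ) : ℂ) * Complex.I := by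
  rw [fourierCoeff_eq_intervalIntegral _ _ 0, zero_add]
  have h1 : ∀ x : ℝ, @fourier (2 * π) (-n) x • liftC f hf hp (x : AddCircle (2 * π)) =
      ((f x * Real.cos (n * x) : ℝ) : ℂ) - ((f x * Real.sin (n * x) : ℝ) : ℂ) * Complex.I := by
    intro x
    rw [liftC_coe, fourier_coe_apply, smul_eq_mul]
    have : (2 * (π:ℂ) * Complex.I * ((-n : ℤ) : ℂ) * x / ((2 * π : ℝ) : ℂ))
        = ((-(n * x) : ℝ) : ℂ) * Complex.I := by
      have : (π : ℂ) ≠ 0 := by exact_mod_cast Real.pi_ne_zero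
      push_cast
      field_simp
    rw [this, Complex.exp_mul_I, ← Complex.ofReal_cos, ← Complex.ofReal_sin, Real.cos_neg,
      Real.sin_neg]
    push_cast
    ring
  simp_rw [h1]
  rw [intervalIntegral.integral_sub, intervalIntegral.integral_mul_const,
    intervalIntegral.integral_ofReal, intervalIntegral.integral_ofReal, Complex.real_smul]
  · push_cast; ring
  · apply Continuous.intervalIntegrable; fun_prop
  · apply Continuous.intervalIntegrable; fun_prop

lemma eq_zero_of_coeffs (f : ℝ → ℝ) (hf : Continuous f) (hp : Function.Periodic f (2 * π))
    (hc : ∀ n : ℕ, ∫ x in (0:ℝ)..(2 * π), f x * Real.cos (n * x) = 0)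
    (hs : ∀ n : ℕ, ∫ x in (0:ℝ)..(2 * π), f x * Real.sin (n * x) = 0) (x : ℝ) : f x = 0 := by
  have h0 : fourierCoeff (liftC f hf hp) = 0 := by
    funext n
    rw [coeff_liftC]
    obtain ⟨m, rfl | rfl⟩ := n.eq_nat_or_neg
    · have h1 := hc m
      have h2 := hs m
      simp [h1, h2]
    · have h1 := hc m
      have h2 := hs m
      simp [h1, h2]
  have h1 := has_pointwise_sum_fourier_series_of_summable (f := liftC f hf hp)
    (by rw [h0]; exact summable_zero) (x : AddCircle (2 * π))
  rw [h0, liftC_coe] at h1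
  simp only [Pi.zero_apply, zero_smul] at h1
  exact_mod_cast h1.unique hasSum_zero

lemma summable_sin_sq (f : ℝ → ℝ) (hf : Continuous f) (hp : Function.Periodic f (2 * π)) :
    Summable (fun n : ℕ =>
      ((1 / (2 * π)) * ∫ x in (0:ℝ)..(2 * π), f x * Real.sin (n * x)) ^ 2) := by
  have h := (hasSum_sq_fourierCoeff
    (ContinuousMap.toLp (E := ℂ) 2 AddCircle.haarAddCircle ℂ (liftC f hf hp))).summable
  simp_rw [fourierCoeff_toLp] at h
  have h2 := h.comp_injective (Nat.cast_injective (R := ℤ))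
  refine Summable.of_nonneg_of_le (fun _ => sq_nonneg _) (fun n => ?_) h2
  simp only [Function.comp, coeff_liftC, ← Complex.normSq_eq_norm_sq, Complex.normSq_apply,
    Int.cast_natCast]
  simp only [Complex.sub_re, Complex.sub_im, Complex.re_ofReal_mul, Complex.im_ofReal_mul,
    Complex.ofReal_re, Complex.ofReal_im, Complex.I_re, Complex.I_im]
  nlinarith [mul_self_nonneg ((1 / (2 * π)) * ∫ x in (0:ℝ)..(2 * π), f x * Real.cos (n * x))]

lemma integral_odd (f : ℝ → ℝ) (hp : Function.Periodic f (2 * π)) (ho : ∀ x, f (-x) = - f x) :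
    ∫ x in (0:ℝ)..(2 * π), f x = 0 := by
  have h1 := hp.intervalIntegral_add_eq 0 (-π)
  rw [zero_add, show -π + 2 * π = π by ring] at h1
  have h2 := intervalIntegral.integral_comp_neg (a := -π) (b := π) f
  simp only [ho, intervalIntegral.integral_neg, neg_neg] at h2
  linarith

lemma per_trig (n : ℕ) (x : ℝ) : Real.cos (n * (x + 2 * π)) = Real.cos (n * x) ∧
    Real.sin (n * (x + 2 * π)) = Real.sin (n * x) := by
  rw [mul_add]
  exact ⟨Real.cos_add_nat_mul_two_pi _ _, Real.sin_add_nat_mul_two_pi _ _⟩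

/-- integration by parts -/
lemma deriv_coeff (p : ℝ → ℝ) (hreg : ContDiff ℝ 1 p) (n : ℕ) :
    ∫ x in (0:ℝ)..(2 * π), deriv p x * Real.sin (n * x)
      = - (2 * π * (n * fourierCoef p n)) := by
  have hd : ∀ x, HasDerivAt p (deriv p x) x := fun x =>
    (hreg.differentiable (by norm_num)).differentiableAt.hasDerivAt
  have hdc : Continuous (deriv p) := hreg.continuous_deriv (by norm_num)
  have hpc := hreg.continuous
  have hs : ∀ x : ℝ, HasDerivAt (fun x => Real.sin (n * x)) (n * Real.cos (n * x)) x := by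
    intro x
    have := ((hasDerivAt_id x).const_mul (n : ℝ)).sin
    simp only [id, mul_one] at this
    rw [mul_comm]
    exact this
  have := intervalIntegral.integral_mul_deriv_eq_deriv_mul (a := 0) (b := 2 * π)
    (fun x _ => hs x) (fun x _ => hd x)
    (by apply Continuous.intervalIntegrable; fun_prop)
    (by apply Continuous.intervalIntegrable; fun_prop)
  have e1 : Real.sin ((n:ℝ) * (2 * π)) = 0 := by
    have := (per_trig n 0).2
    simpa using this
  rw [e1] at this
  simp only [mul_zero, Real.sin_zero, zero_mul, sub_zero, zero_sub] at this
  calc _ = ∫ x in (0:ℝ)..(2 * π), Real.sin (n * x) * deriv p x := by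
        congr 1; funext x; ring
    _ = _ := this
    _ = - (n * ∫ x in (0:ℝ)..(2 * π), p x * Real.cos (n * x)) := by
        rw [← intervalIntegral.integral_const_mul]; congr 2; funext x; ring
    _ = _ := by
        unfold fourierCoef
        have := Real.pi_ne_zero
        field_simp

lemma summable_coef (p : ℝ → ℝ) (hreg : ContDiff ℝ 1 p) (hper : Function.Periodic p (2 * π)) :
    Summable (fun n : ℕ => |fourierCoef p (n + 1)|) := by
  have hdc : Continuous (deriv p) := hreg.continuous_deriv (by norm_num)
  have hdp : Function.Periodic (deriv p) (2 * π) := by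
    intro x
    rw [← deriv_comp_add_const]
    congr 1
    funext y
    exact hper y
  have h := (summable_nat_add_iff 1).2 (summable_sin_sq _ hdc hdp)
  have h2 : Summable (fun n : ℕ => 1 / ((n + 1 : ℕ) : ℝ) ^ 2) :=
    (summable_nat_add_iff 1).2 (Real.summable_one_div_nat_pow.2 (by norm_num : 1 < 2))
  refine Summable.of_nonneg_of_le (fun _ => abs_nonneg _) (fun n => ?_) (h.add h2)
  rw [deriv_coeff p hreg]
  have hpi := Real.pi_ne_zero
  have e : (1 / (2 * π)) * -(2 * π * (((n + 1 : ℕ) : ℝ) * fourierCoef p (n + 1)))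
      = - (((n + 1 : ℕ) : ℝ) * fourierCoef p (n + 1)) := by field_simp
  rw [e]
  have hn : (0 : ℝ) < ((n + 1 : ℕ) : ℝ) := by positivity
  set N : ℝ := ((n + 1 : ℕ) : ℝ)
  set y := fourierCoef p (n + 1)
  have e2 : |y| = (N * |y|) * (1 / N) := by field_simp
  have e3 : (-(N * y)) ^ 2 = (N * |y|) ^ 2 := by rw [neg_sq, mul_pow, mul_pow, sq_abs]
  rw [e3, ← one_div_pow, e2]
  rw [← e2]
  nlinarith [sq_nonneg (N * |y| - 1 / N), sq_nonneg (N * |y|), sq_nonneg (1 / N)]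

lemma coef_le_one (p : ℝ → ℝ) (hc : Continuous p) (hnonneg : ∀ θ : ℝ, 0 ≤ p θ)
    (hmass : (1 / (2 * π)) * ∫ θ in (0:ℝ)..(2 * π), p θ = 1) (n : ℕ) :
    |fourierCoef p n| ≤ 1 := by
  unfold fourierCoef
  rw [abs_mul, abs_of_nonneg (by positivity : 0 ≤ 1 / (2 * π))]
  refine le_of_le_of_eq ?_ hmass
  refine mul_le_mul_of_nonneg_left ?_ (by positivity)
  refine (intervalIntegral.abs_integral_le_integral_abs (by positivity)).trans ?_
  apply intervalIntegral.integral_mono_on (by positivity)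
  · apply Continuous.intervalIntegrable; fun_prop
  · apply Continuous.intervalIntegrable; fun_prop
  · intro x _
    rw [abs_mul, abs_of_nonneg (hnonneg x)]
    exact mul_le_of_le_one_right (hnonneg x) (Real.abs_cos_le_one _)

lemma int_sin_sin (p : ℝ → ℝ) (hc : Continuous p) (j l : ℕ) :
    ∫ x in (0:ℝ)..(2 * π), p x * (Real.sin (j * x) * Real.sin (l * x))
      = π * (fourierCoef p ((j : ℤ) - l).natAbs - fourierCoef p (j + l)) := by
  have h1 : ∀ x : ℝ, p x * (Real.sin (j * x) * Real.sin (l * x)) =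
      (1 / 2) * (p x * Real.cos ((((j : ℤ) - l).natAbs : ℝ) * x)
        - p x * Real.cos (((j + l : ℕ) : ℝ) * x)) := by
    intro x
    have e : Real.cos ((((j : ℤ) - l).natAbs : ℝ) * x) = Real.cos (j * x - l * x) := by
      rw [Nat.cast_natAbs]
      push_cast
      rw [← sub_mul]
      rcases abs_choice ((j : ℝ) - l) with h | h <;> rw [h]
      rw [neg_mul, Real.cos_neg]
    rw [e]
    push_cast
    rw [add_mul, Real.cos_sub, Real.cos_add]
    ring
  simp_rw [h1]
  rw [intervalIntegral.integral_const_mul, intervalIntegral.integral_sub]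
  · unfold fourierCoef
    have := Real.pi_ne_zero
    field_simp
  · apply Continuous.intervalIntegrable; fun_prop
  · apply Continuous.intervalIntegrable; fun_prop

lemma Gderiv_term_le (a : ℕ → ℝ) (p : ℝ → ℝ) (n : ℕ) (θ : ℝ) :
    ‖-(a (n + 1) * fourierCoef p (n + 1) * ((n + 1 : ℕ) : ℝ)
      * Real.sin (((n + 1 : ℕ) : ℝ) * θ))‖
      ≤ ((n + 1 : ℕ) : ℝ) * |a (n + 1) * fourierCoef p (n + 1)| := by
  rw [norm_neg, norm_mul, norm_mul, Real.norm_eq_abs, Real.norm_eq_abs, Real.norm_eq_abs,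
    Nat.abs_cast, mul_comm (|a (n + 1) * fourierCoef p (n + 1)|)]
  exact mul_le_of_le_one_right (by positivity) (Real.abs_sin_le_one _)

lemma Gderiv_continuous (a : ℕ → ℝ) (p : ℝ → ℝ)
    (hu : Summable fun ℓ : ℕ => ((ℓ + 1 : ℕ) : ℝ) * |a (ℓ + 1) * fourierCoef p (ℓ + 1)|) :
    Continuous (Gderiv a p) := by
  unfold Gderiv
  exact continuous_tsum (fun n => by fun_prop) hu (fun n θ => Gderiv_term_le a p n θ)

lemma Gfun_hasDerivAt (a : ℕ → ℝ) (p : ℝ → ℝ)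
    (hu : Summable fun ℓ : ℕ => ((ℓ + 1 : ℕ) : ℝ) * |a (ℓ + 1) * fourierCoef p (ℓ + 1)|)
    (θ : ℝ) : HasDerivAt (Gfun a p) (Gderiv a p θ) θ := by
  unfold Gfun Gderiv
  refine hasDerivAt_tsum (y₀ := 0) hu (fun n y => ?_) (fun n y => Gderiv_term_le a p n y) ?_ θ
  · have h := (((hasDerivAt_id y).const_mul (((n + 1 : ℕ) : ℝ))).cos).const_mul
      (a (n + 1) * fourierCoef p (n + 1))
    simp only [id, mul_one] at h
    convert! h using 1
    ring
  · refine Summable.of_norm_bounded hu (fun n => ?_)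
    simp only [mul_zero, Real.cos_zero, mul_one, Real.norm_eq_abs]
    refine le_mul_of_one_le_left (abs_nonneg _) ?_
    push_cast
    linarith [(Nat.cast_nonneg n : (0:ℝ) ≤ n)]

lemma Gderiv_coeff (a : ℕ → ℝ) (p : ℝ → ℝ) (hc : Continuous p)
    (hu : Summable fun ℓ : ℕ => ((ℓ + 1 : ℕ) : ℝ) * |a (ℓ + 1) * fourierCoef p (ℓ + 1)|)
    (l : ℕ) :
    HasSum (fun n : ℕ => -π * (((n + 1 : ℕ) : ℝ) * a (n + 1) * fourierCoef p (n + 1) *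
      (fourierCoef p (((n + 1 : ℕ) : ℤ) - l).natAbs - fourierCoef p (n + 1 + l))))
      (∫ x in (0:ℝ)..(2 * π), Gderiv a p x * p x * Real.sin (l * x)) := by
  have h := intervalIntegral.hasSum_integral_of_dominated_convergence
    (a := 0) (b := 2 * π) (μ := MeasureTheory.volume)
    (F := fun n x => -(a (n + 1) * fourierCoef p (n + 1) * ((n + 1 : ℕ) : ℝ)
      * Real.sin (((n + 1 : ℕ) : ℝ) * x)) * p x * Real.sin (l * x))
    (f := fun x => Gderiv a p x * p x * Real.sin (l * x))
    (fun n x => ((n + 1 : ℕ) : ℝ) * |a (n + 1) * fourierCoef p (n + 1)| * |p x|)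
    (fun n => by apply Continuous.aestronglyMeasurable; fun_prop)
    (by
      intro n
      refine Filter.Eventually.of_forall (fun x _ => ?_)
      rw [norm_mul, norm_mul]
      refine (mul_le_of_le_one_right (by positivity) (Real.abs_sin_le_one _)).trans ?_
      exact mul_le_mul_of_nonneg_right (Gderiv_term_le a p n x) (norm_nonneg _))
    (Filter.Eventually.of_forall (fun x _ => hu.mul_right _))
    (by
      simp_rw [tsum_mul_right]
      apply Continuous.intervalIntegrable; fun_prop)
    (Filter.Eventually.of_forall (fun x _ => by
      have : Summable (fun n : ℕ => -(a (n + 1) * fourierCoef p (n + 1) * ((n + 1 : ℕ) : ℝ)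
        * Real.sin (((n + 1 : ℕ) : ℝ) * x))) :=
        Summable.of_norm_bounded hu (fun n => Gderiv_term_le a p n x)
      exact (this.hasSum.mul_right _).mul_right _))
  convert! h using 1
  funext n
  have := int_sin_sin p hc (n + 1) l
  calc _ = -(((n + 1 : ℕ) : ℝ) * a (n + 1) * fourierCoef p (n + 1)) * (π *
      (fourierCoef p (((n + 1 : ℕ) : ℤ) - l).natAbs - fourierCoef p (n + 1 + l))) := by ring
    _ = _ := by
      rw [← this, ← intervalIntegral.integral_const_mul]
      congr 1; funext x; ring

/-- Algebraic reindexing. -/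
lemma reindex (b x : ℕ → ℝ) (hb : Summable (fun n => |b (n + 1)|)) (hx : ∀ n, |x n| ≤ 1)
    (hx0 : x 0 = 1) (l : ℕ) (hl : 1 ≤ l) :
    Summable (fun k : ℕ => b (l + k + 1) * x (k + 1) - b (k + 1) * x (l + k + 1)) ∧
    ∑' n : ℕ, b (n + 1) * (x (((n + 1 : ℕ) : ℤ) - l).natAbs - x (n + 1 + l))
      = b l + ∑ j ∈ Finset.Ico 1 l, b j * x (l - j)
        + ∑' k : ℕ, (b (l + k + 1) * x (k + 1) - b (k + 1) * x (l + k + 1)) := by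
  have hs : ∀ y : ℕ → ℕ, Summable (fun n => b (n + 1) * x (y n)) := fun y =>
    Summable.of_norm_bounded hb (fun n => by
      rw [norm_mul]
      exact mul_le_of_le_one_right (abs_nonneg _) (hx _))
  have s1 := hs (fun n => (((n + 1 : ℕ) : ℤ) - l).natAbs)
  have s2 := hs (fun n => l + n + 1)
  have s3 : Summable (fun k => b (l + k + 1) * x (k + 1)) := by
    have := (summable_nat_add_iff l).2 s1
    refine this.congr (fun k => ?_)
    have e : (((k + l + 1 : ℕ) : ℤ) - l).natAbs = k + 1 := by omega
    rw [e, add_comm k l]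
  refine ⟨s3.sub s2, ?_⟩
  rw [s3.tsum_sub s2]
  have e1 : ∑' n : ℕ, b (n + 1) * (x (((n + 1 : ℕ) : ℤ) - l).natAbs - x (n + 1 + l))
      = ∑' n : ℕ, b (n + 1) * x (((n + 1 : ℕ) : ℤ) - l).natAbs
        - ∑' n : ℕ, b (n + 1) * x (l + n + 1) := by
    rw [← s1.tsum_sub s2]
    congr 1; funext n
    rw [show n + 1 + l = l + n + 1 by ring]; ring
  rw [e1, ← s1.sum_add_tsum_nat_add l]
  have e2 : ∑' i : ℕ, b (i + l + 1) * x (((i + l + 1 : ℕ) : ℤ) - l).natAbs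
      = ∑' k : ℕ, b (l + k + 1) * x (k + 1) := by
    congr 1; funext k
    have e : (((k + l + 1 : ℕ) : ℤ) - l).natAbs = k + 1 := by omega
    rw [e, add_comm k l]
  rw [e2]
  obtain ⟨m, rfl⟩ : ∃ m, l = m + 1 := ⟨l - 1, by omega⟩
  rw [Finset.sum_range_succ, Finset.sum_Ico_eq_sum_range]
  have e3 : ∑ i ∈ Finset.range m, b (i + 1) * x (((i + 1 : ℕ) : ℤ) - ((m + 1 : ℕ) : ℤ)).natAbs
      = ∑ k ∈ Finset.range (m + 1 - 1), b (1 + k) * x (m + 1 - (1 + k)) := by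
    refine Finset.sum_congr (by simp) (fun i hi => ?_)
    have := Finset.mem_range.1 hi
    rw [add_comm i 1]
    congr 2
    omega
  rw [e3]
  simp only [sub_self, Int.natAbs_zero, hx0]
  ring

/-- a `C¹`, even, `2π`-periodic probability density `p` solves the stationary
McKean–Vlasov equation `p′ = κ (W⋆p)′ p` iff its Fourier coefficients solve the quadratic
Fourier system; moreover any solution is strictly positive and has the Gibbs form
`p = e^{κG}/Z`. -/
theorem stationary_iff_fourier_system
    (a : ℕ → ℝ) (hA : ∃ C : ℝ, ∀ ℓ : ℕ, 1 ≤ ℓ → (ℓ : ℝ) * |a ℓ| ≤ C)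
    (κ : ℝ) (hκ : 0 < κ) (p : ℝ → ℝ)
    (hreg : ContDiff ℝ 1 p)
    (hper : Function.Periodic p (2 * π))
    (heven : ∀ θ : ℝ, p (-θ) = p θ)
    (hnonneg : ∀ θ : ℝ, 0 ≤ p θ)
    (hmass : (1 / (2 * π)) * ∫ θ in (0:ℝ)..(2 * π), p θ = 1) :
    (Summable fun ℓ : ℕ => ((ℓ + 1 : ℕ) : ℝ) * |a (ℓ + 1) * fourierCoef p (ℓ + 1)|) ∧
    (∀ θ : ℝ, HasDerivAt (Gfun a p) (Gderiv a p θ) θ) ∧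
    ((∀ θ : ℝ, deriv p θ = κ * Gderiv a p θ * p θ) ↔ SolvesMV a κ (fourierCoef p)) ∧
    ((∀ θ : ℝ, deriv p θ = κ * Gderiv a p θ * p θ) →
      (∀ θ : ℝ, 0 < p θ) ∧
      ∀ θ : ℝ, p θ = Real.exp (κ * Gfun a p θ) / Zconst a κ p) := by

  obtain ⟨C, hC⟩ := hA
  have hpc : Continuous p := hreg.continuous
  have hdc : Continuous (deriv p) := hreg.continuous_deriv (by norm_num)
  have hd : ∀ x, HasDerivAt p (deriv p x) x := fun x =>
    (hreg.differentiable (by norm_num)).differentiableAt.hasDerivAt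
  have hu : Summable fun ℓ : ℕ => ((ℓ + 1 : ℕ) : ℝ) * |a (ℓ + 1) * fourierCoef p (ℓ + 1)| := by
    refine Summable.of_nonneg_of_le (fun n => by positivity) (fun n => ?_)
      ((summable_coef p hreg hper).mul_left C)
    rw [abs_mul, ← mul_assoc]
    exact mul_le_mul_of_nonneg_right (hC (n + 1) (by omega)) (abs_nonneg _)
  have hG := Gfun_hasDerivAt a p hu
  have hGc := Gderiv_continuous a p hu
  refine ⟨hu, hG, ?_, ?_⟩
  · set x := fourierCoef p with hx
    have hx0 : x 0 = 1 := by
      rw [hx, ← hmass]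
      simp [fourierCoef]
    have hx1 : ∀ n, |x n| ≤ 1 := coef_le_one p hpc hnonneg hmass
    have hb : Summable (fun n : ℕ => |((n + 1 : ℕ) : ℝ) * a (n + 1) * x (n + 1)|) := by
      refine hu.congr (fun n => ?_)
      rw [mul_assoc, abs_mul ((n + 1 : ℕ) : ℝ), Nat.abs_cast]
    have hR := reindex (fun n => (n : ℝ) * a n * x n) x hb hx1 hx0
    -- sine coefficients of the defect
    have hcoef : ∀ l : ℕ, 1 ≤ l →
        ∫ θ in (0:ℝ)..(2 * π), (deriv p θ - κ * Gderiv a p θ * p θ) * Real.sin (l * θ)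
        = π * (κ * (l * a l * x l + ∑ j ∈ Finset.Ico 1 l, (j : ℝ) * a j * x j * x (l - j)
          + ∑' k : ℕ, (((l + k + 1 : ℕ) : ℝ) * a (l + k + 1) * x (l + k + 1) * x (k + 1)
            - ((k + 1 : ℕ) : ℝ) * a (k + 1) * x (k + 1) * x (l + k + 1))) - 2 * (l * x l)) := by
      intro l hl
      have h1 := (Gderiv_coeff a p hpc hu l).tsum_eq
      rw [tsum_mul_left] at h1
      have h2 := (hR l hl).2
      have h3 : ∫ θ in (0:ℝ)..(2 * π), (deriv p θ - κ * Gderiv a p θ * p θ) * Real.sin (l * θ)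
          = (∫ θ in (0:ℝ)..(2 * π), deriv p θ * Real.sin (l * θ))
            - κ * ∫ θ in (0:ℝ)..(2 * π), Gderiv a p θ * p θ * Real.sin (l * θ) := by
        rw [← intervalIntegral.integral_const_mul, ← intervalIntegral.integral_sub]
        · congr 1; funext θ; ring
        · apply Continuous.intervalIntegrable; fun_prop
        · apply Continuous.intervalIntegrable; fun_prop
      rw [h3, deriv_coeff p hreg, ← h1, ← h2]
      ring
    have hts : ∀ l : ℕ, (fun k : ℕ =>
        (((l + k + 1 : ℕ) : ℝ) * a (l + k + 1) - ((k + 1 : ℕ) : ℝ) * a (k + 1))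
        * x (l + k + 1) * x (k + 1)) = fun k : ℕ =>
        (((l + k + 1 : ℕ) : ℝ) * a (l + k + 1) * x (l + k + 1) * x (k + 1)
            - ((k + 1 : ℕ) : ℝ) * a (k + 1) * x (k + 1) * x (l + k + 1)) := by
      intro l; funext k; ring
    have key : SolvesMV a κ x ↔ ∀ l : ℕ, 1 ≤ l →
        ∫ θ in (0:ℝ)..(2 * π), (deriv p θ - κ * Gderiv a p θ * p θ) * Real.sin (l * θ) = 0 := by
      unfold SolvesMV
      refine forall_congr' (fun l => forall_congr' (fun hl => ?_))
      rw [hcoef l hl, hts l]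
      constructor
      · rintro ⟨-, h⟩
        rw [mul_eq_zero]
        right
        linarith
      · intro h
        refine ⟨(hR l hl).1, ?_⟩
        rw [mul_eq_zero] at h
        have h' := h.resolve_left Real.pi_ne_zero
        linarith
    rw [key]
    constructor
    · intro h l _
      simp [h]
    · intro h
      have hdo : ∀ θ, deriv p (-θ) = - deriv p θ := by
        intro θ
        have h1 := deriv_comp_neg p θ
        have h2 : (fun x => p (-x)) = p := funext heven
        rw [h2] at h1
        linarith
      have hdp : Function.Periodic (deriv p) (2 * π) := by
        intro x
        rw [← deriv_comp_add_const]
        congr 1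
        funext y
        exact hper y
      have hGo : ∀ θ, Gderiv a p (-θ) = - Gderiv a p θ := by
        intro θ
        unfold Gderiv
        rw [← tsum_neg]
        congr 1; funext n
        rw [mul_neg, Real.sin_neg]; ring
      have hGp : Function.Periodic (Gderiv a p) (2 * π) := by
        intro θ
        unfold Gderiv
        congr 1; funext n
        rw [(per_trig (n + 1) θ).2]
      have hz := eq_zero_of_coeffs (fun θ => deriv p θ - κ * Gderiv a p θ * p θ) (by fun_prop)
        (fun θ => by simp only [hdp θ, hGp θ, hper θ])
        (fun n => integral_odd _
          (fun θ => by simp only [hdp θ, hGp θ, hper θ, (per_trig n θ).1])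
          (fun θ => by
            simp only [hdo, hGo, heven, mul_neg, Real.cos_neg]; ring))
        (fun n => by
          rcases Nat.eq_zero_or_pos n with rfl | hn
          · simp
          · exact h n hn)
      intro θ
      have := hz θ
      linarith
  · intro h
    have hq : ∀ θ, HasDerivAt (fun θ => p θ * Real.exp (-(κ * Gfun a p θ))) 0 θ := by
      intro θ
      have h1 := (hd θ).mul (((hG θ).const_mul κ).neg.exp)
      convert! h1 using 1
      rw [h θ]
      ring
    have hconst : ∀ θ, p θ * Real.exp (-(κ * Gfun a p θ)) = p 0 * Real.exp (-(κ * Gfun a p 0)) :=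
      fun θ => is_const_of_deriv_eq_zero (fun θ => (hq θ).differentiableAt)
        (fun θ => (hq θ).deriv) θ 0
    set c := p 0 * Real.exp (-(κ * Gfun a p 0)) with hcdef
    have hpe : ∀ θ, p θ = c * Real.exp (κ * Gfun a p θ) := by
      intro θ
      rw [← hconst θ, mul_assoc, ← Real.exp_add]
      simp
    have hcZ : c * Zconst a κ p = 1 := by
      rw [← hmass]
      simp_rw [hpe]
      rw [intervalIntegral.integral_const_mul]
      unfold Zconst
      ring
    have hc0 : 0 < c := by
      have h1 : 0 ≤ c := mul_nonneg (hnonneg 0) (Real.exp_pos _).le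
      refine lt_of_le_of_ne h1 (fun h2 => ?_)
      rw [← h2] at hcZ
      simp at hcZ
    have hcZ' : c = 1 / Zconst a κ p := eq_one_div_of_mul_eq_one_left hcZ
    refine ⟨fun θ => ?_, fun θ => ?_⟩
    · rw [hpe θ]
      exact mul_pos hc0 (Real.exp_pos _)
    · rw [hpe θ, hcZ']
      ring
end
end

section
/- Assume sup_{ℓ≥1} ℓ|a_ℓ| < ∞, and that there is ℓ* ≥ 1 with a_{ℓ*} > 0 and a_ℓ ≠ a_{ℓ*} for every ℓ ≠ ℓ*. Set κ* := 2/a_{ℓ*}. Then there exist δ > 0, a continuous curve p : (−δ,δ) → ℓ²_w and a twice-differentiable function κ : (−δ,δ) → (0,∞) such that: (i) p(0) = 0 and for every s ∈ (−δ,δ), p(s) solves the stationary Fourier system at κ(s); (ii) p(s) ≠ 0 for s ≠ 0; (iii) ‖p(s) − s·e_{ℓ*}‖_w/|s| → 0 as s → 0; (iv) κ(0) = κ*, κ′(0) = 0 and κ″(0) = (2/a_{ℓ*})·(a_{ℓ*} − 2a_{2ℓ*})/(a_{ℓ*} − a_{2ℓ*}); (v) there is ε > 0 such that every pair (x, κ)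 with x ∈ ℓ²_w, 0 < ‖x‖_w < ε, |κ − κ*| < ε and x solving the stationary Fourier system at κ equals (p(s), κ(s)) for some s ∈ (−δ,δ). -/
open scoped BigOperators
open Filter Topology Real

noncomputable section

abbrev PFE : Type := lp (fun _ : ℕ => ℝ) 1

lemma pf_hasSum_norm (x : PFE) : HasSum (fun j => |x j|) ‖x‖ := by
  have := lp.hasSum_norm (p := 1) (by simp) x
  simpa using this

lemma pf_mk (x : ℕ → ℝ) (hx : Summable fun j => |x j|) : ∃ X : PFE, ∀ j, X j = x j :=
  ⟨⟨x, memℓp_gen (by simpa using hx)⟩, fun _ => rfl⟩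

lemma pf_lift {F : Type*} [NormedAddCommGroup F] [NormedSpace ℝ F] [CompleteSpace F]
    (v : ℕ → F) (C : ℝ) (hv : ∀ j, ‖v j‖ ≤ C) :
    ∃ L : PFE →L[ℝ] F, (∀ x : PFE, HasSum (fun j => x j • v j) (L x)) ∧ ‖L‖ ≤ C := by
  have hC : 0 ≤ C := (norm_nonneg _).trans (hv 0)
  have hb : ∀ (x : PFE) j, ‖x j • v j‖ ≤ |x j| * C := by
    intro x j
    rw [norm_smul]
    exact mul_le_mul_of_nonneg_left (hv j) (norm_nonneg _)
  have hsn : ∀ x : PFE, Summable (fun j => ‖x j • v j‖) := fun x =>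
    Summable.of_nonneg_of_le (fun _ => norm_nonneg _) (hb x) ((pf_hasSum_norm x).summable.mul_right C)
  have hs : ∀ x : PFE, Summable (fun j => x j • v j) := fun x => (hsn x).of_norm
  let L0 : PFE →ₗ[ℝ] F :=
    { toFun := fun x => ∑' j, x j • v j
      map_add' := fun x y => by
        rw [← (hs x).tsum_add (hs y)]
        congr 1; ext j
        simp [add_smul]
      map_smul' := fun r x => by
        simp only [RingHom.id_apply]
        rw [← (hs x).tsum_const_smul]
        congr 1; ext j
        simp [mul_smul] }
  have hL0 : ∀ x, ‖L0 x‖ ≤ C * ‖x‖ := by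
    intro x
    refine (norm_tsum_le_tsum_norm (hsn x)).trans ?_
    refine ((hsn x).tsum_le_tsum (hb x) ((pf_hasSum_norm x).summable.mul_right C)).trans ?_
    rw [tsum_mul_right, (pf_hasSum_norm x).tsum_eq, mul_comm]
  exact ⟨L0.mkContinuous C hL0, fun x => (hs x).hasSum, L0.mkContinuous_norm_le hC hL0⟩

lemma pf_diag (d : ℕ → ℝ) (C : ℝ) (hd : ∀ j, |d j| ≤ C) :
    ∃ D : PFE →L[ℝ] PFE, (∀ x l, D x l = d l * x l) ∧ ‖D‖ ≤ C := by
  obtain ⟨D, hD, hDn⟩ := pf_lift (fun j => (lp.single 1 j (d j) : PFE)) C (fun j => by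
    rw [lp.norm_single (by simp)]; exact hd j)
  refine ⟨D, fun x l => ?_, hDn⟩
  have h := (hD x).mapL (lp.evalCLM ℝ (fun _ : ℕ => ℝ) 1 l)
  have h2 : HasSum (fun j => lp.evalCLM ℝ (fun _ : ℕ => ℝ) 1 l (x j • (lp.single 1 j (d j) : PFE)))
      (d l * x l) := by
    have : d l * x l = lp.evalCLM ℝ (fun _ : ℕ => ℝ) 1 l (x l • (lp.single 1 l (d l) : PFE)) := by
      change _ = x l * (lp.single 1 l (d l) : PFE) l
      rw [lp.single_apply_self]; ring
    rw [this]
    apply hasSum_single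
    intro j hj
    change x j * (lp.single 1 j (d j) : PFE) l = 0
    rw [lp.single_apply_ne _ _ _ hj.symm]; ring
  exact h.unique h2

lemma pf_bilin (c : ℕ → ℝ) (C : ℝ) (hc : ∀ j, |c j| ≤ C) :
    ∃ Q : PFE →L[ℝ] PFE →L[ℝ] PFE,
      (∀ x y : PFE, Q x y 0 = 0) ∧
      (∀ j k l : ℕ, 1 ≤ k → Q (lp.single 1 j (1:ℝ)) (lp.single 1 k (1:ℝ)) l =
        (if j + k = l then c j else 0) +
        (if j - k = l then (if k < j then c j - c k else 0) else 0)) ∧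
      ∀ x y : PFE, x 0 = 0 → y 0 = 0 → ∀ l : ℕ, 1 ≤ l →
        Summable (fun k : ℕ => (c (l + k + 1) - c (k + 1)) * x (l + k + 1) * y (k + 1)) ∧
        Q x y l = ∑ j ∈ Finset.Ico 1 l, c j * x j * y (l - j)
          + ∑' k : ℕ, (c (l + k + 1) - c (k + 1)) * x (l + k + 1) * y (k + 1) := by
  have hC : 0 ≤ C := (abs_nonneg _).trans (hc 0)
  let v : ℕ → ℕ → PFE := fun j k => lp.single 1 (j + k) (if j = 0 ∧ k = 0 then 0 else c j) +
    lp.single 1 (j - k) (if k < j then c j - c k else 0)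
  have hv : ∀ j k, ‖v j k‖ ≤ 3 * C := by
    intro j k
    refine (norm_add_le _ _).trans ?_
    rw [lp.norm_single (by simp), lp.norm_single (by simp)]
    have h1 := hc j
    have h2 := hc k
    have h3 : ‖(if j = 0 ∧ k = 0 then 0 else c j : ℝ)‖ ≤ C := by
      split_ifs
      · simpa using hC
      · exact h1
    have h4 : ‖(if k < j then c j - c k else 0 : ℝ)‖ ≤ 2 * C := by
      split_ifs
      · refine (norm_sub_le _ _).trans ?_
        simp only [Real.norm_eq_abs]; linarith
      · simpa using hC
    linarith
  choose B hB hBn using fun j => pf_lift (v j) (3 * C) (hv j)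
  obtain ⟨Q, hQ, -⟩ := pf_lift B (3 * C) hBn
  have hv1 : ∀ j k l, v j k l = (if j + k = l then (if j = 0 ∧ k = 0 then 0 else c j) else 0) +
      (if j - k = l then (if k < j then c j - c k else 0) else 0) := by
    intro j k l
    change (lp.single 1 (j + k) (if j = 0 ∧ k = 0 then 0 else c j) : PFE) l +
      (lp.single 1 (j - k) (if k < j then c j - c k else 0) : PFE) l = _
    simp only [lp.single_apply, Pi.single_apply, eq_comm]
  have hBy : ∀ j (y : PFE) l, HasSum (fun k => y k * v j k l) (B j y l) := fun j y l =>
    (hB j y).mapL (lp.evalCLM ℝ (fun _ : ℕ => ℝ) 1 l)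
  have hQxy : ∀ (x y : PFE) l, HasSum (fun j => x j * B j y l) (Q x y l) := fun x y l =>
    (hQ x).mapL ((lp.evalCLM ℝ (fun _ : ℕ => ℝ) 1 l).comp
      (ContinuousLinearMap.apply ℝ PFE y))
  have hB0 : ∀ j (y : PFE), B j y 0 = 0 := by
    intro j y
    refine (hBy j y 0).unique ?_
    convert hasSum_zero using 2 with k
    rw [hv1]
    have h1 : (if j + k = 0 then (if j = 0 ∧ k = 0 then 0 else c j) else 0 : ℝ) = 0 := by
      split_ifs <;> first | rfl | omega
    have h2 : (if j - k = 0 then (if k < j then c j - c k else 0) else 0 : ℝ) = 0 := by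
      split_ifs <;> first | rfl | omega
    rw [h1, h2]; ring
  have hsing : ∀ {F : Type} [NormedAddCommGroup F] [NormedSpace ℝ F] (j : ℕ) (w : ℕ → F),
      HasSum (fun i => (lp.single 1 j (1:ℝ) : PFE) i • w i) (w j) := by
    intro F _ _ j w
    have hh := hasSum_single (f := fun i => (lp.single 1 j (1:ℝ) : PFE) i • w i) j (fun i hi => by
      rw [lp.single_apply_ne _ _ _ hi, zero_smul])
    simp only at hh
    rwa [lp.single_apply_self, one_smul] at hh
  have hQs : ∀ j k : ℕ, Q (lp.single 1 j (1:ℝ)) (lp.single 1 k (1:ℝ)) = v j k := by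
    intro j k
    rw [(hQ (lp.single 1 j (1:ℝ))).unique (hsing j B)]
    exact (hB j (lp.single 1 k (1:ℝ))).unique (hsing k (v j))
  refine ⟨Q, fun x y => ?_, fun j k l hk => ?_, fun x y hx hy l hl => ?_⟩
  · refine (hQxy x y 0).unique ?_
    simp only [hB0, mul_zero]
    exact hasSum_zero
  · rw [hQs, hv1]
    have : ¬ (j = 0 ∧ k = 0) := by omega
    simp only [if_neg this]
  · have hBl : ∀ j, B j y l = (if j < l then c j * y (l - j) else 0) +
        (if l < j then (c j - c (j - l)) * y (j - l) else 0) := by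
      intro j
      refine (hBy j y l).unique ?_
      simp only [hv1, mul_add]
      refine HasSum.add ?_ ?_
      · have : (if j < l then c j * y (l - j) else 0) =
          y (l - j) * (if j + (l - j) = l then (if j = 0 ∧ (l - j) = 0 then 0 else c j) else 0) := by
          by_cases h : j < l
          · rw [if_pos h, if_pos (by omega), if_neg (by omega)]; ring
          · rw [if_neg h]
            have : l - j = 0 := by omega
            rw [this, hy, zero_mul]
        rw [this]
        apply hasSum_single
        intro k hk
        by_cases h : j + k = l
        · omega
        · rw [if_neg h, mul_zero]
      · have : (if l < j then (c j - c (j - l)) * y (j - l) else 0) =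
          y (j - l) * (if j - (j - l) = l then (if j - l < j then c j - c (j - l) else 0) else 0) := by
          by_cases h : l < j
          · rw [if_pos h, if_pos (by omega), if_pos (by omega)]; ring
          · rw [if_neg h]
            have : j - l = 0 := by omega
            rw [this, hy, zero_mul]
        rw [this]
        apply hasSum_single
        intro k hk
        by_cases h : j - k = l
        · omega
        · rw [if_neg h, mul_zero]
    have h0 := hQxy x y l
    have h1 : HasSum (fun j => x j * (if j < l then c j * y (l - j) else 0))
        (∑ j ∈ Finset.Ico 1 l, c j * x j * y (l - j)) := by
      have : ∑ j ∈ Finset.Ico 1 l, c j * x j * y (l - j) =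
          ∑ j ∈ Finset.Ico 1 l, x j * (if j < l then c j * y (l - j) else 0) := by
        refine Finset.sum_congr rfl fun j hj => ?_
        rw [if_pos (Finset.mem_Ico.1 hj).2]; ring
      rw [this]
      apply hasSum_sum_of_ne_finset_zero
      intro j hj
      rw [Finset.mem_Ico] at hj
      by_cases h : j = 0
      · rw [h, hx, zero_mul]
      · rw [if_neg (by omega), mul_zero]
    have h2 : HasSum (fun j => x j * (if l < j then (c j - c (j - l)) * y (j - l) else 0))
        (Q x y l - ∑ j ∈ Finset.Ico 1 l, c j * x j * y (l - j)) := by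
      have he : (fun j => x j * (if l < j then (c j - c (j - l)) * y (j - l) else 0)) =
          fun j => x j * B j y l - x j * (if j < l then c j * y (l - j) else 0) := by
        ext j
        rw [hBl]; ring
      rw [he]
      exact h0.sub h1
    have hinj : Function.Injective (fun k : ℕ => l + k + 1) := fun k k' h => by
      simp only at h; omega
    have h3 := (hinj.hasSum_iff (f := fun j => x j * (if l < j then (c j - c (j - l)) * y (j - l) else 0))
      (a := Q x y l - ∑ j ∈ Finset.Ico 1 l, c j * x j * y (l - j)) (fun j hj => by
        have : ¬ l < j := fun h => hj ⟨j - l - 1, by simp only; omega⟩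
        rw [if_neg this, mul_zero])).2 h2
    have h4 : HasSum (fun k : ℕ => (c (l + k + 1) - c (k + 1)) * x (l + k + 1) * y (k + 1))
        (Q x y l - ∑ j ∈ Finset.Ico 1 l, c j * x j * y (l - j)) := by
      convert h3 using 2 with k
      simp only [Function.comp]
      rw [if_pos (by omega), show l + k + 1 - l = k + 1 by omega]; ring
    refine ⟨h4.summable, ?_⟩
    rw [h4.tsum_eq]; ring

open scoped ContDiff in
lemma pf_ift {E : Type*} [NormedAddCommGroup E] [NormedSpace ℝ E] [CompleteSpace E]
    (f : ℝ × E → E) (hf : ContDiff ℝ ω f) (h0 : f (0, 0) = 0) (D : E ≃L[ℝ] E)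
    (hD : HasFDerivAt (fun u => f (0, u)) (D : E →L[ℝ] E) 0) :
    ∃ u : ℝ → E, u 0 = 0 ∧ ContDiffAt ℝ 3 u 0 ∧ (∀ᶠ s in 𝓝 (0:ℝ), f (s, u s) = 0) ∧
      ∀ᶠ v in 𝓝 ((0:ℝ), (0:E)), f v = 0 → u v.1 = v.2 := by
  have hfa : ContDiffAt ℝ 3 f (0, 0) := (hf.of_le le_top).contDiffAt
  have hinv : (fderiv ℝ f (0, 0) ∘L .inr ℝ ℝ E).IsInvertible := by
    refine ⟨D, ?_⟩
    have h1 : HasFDerivAt f (fderiv ℝ f (0, 0)) ((0:ℝ), (0:E)) :=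
      (hfa.differentiableAt (by simp)).hasFDerivAt
    have h2 := HasFDerivAt.comp (0:E) (f := fun u : E => ((0:ℝ), u)) h1 (hasFDerivAt_prodMk_right 0 0)
    exact hD.unique h2
  refine ⟨hfa.implicitFunction (by simp) hinv, hfa.implicitFunction_apply_self _ hinv,
    hfa.contDiffAt_implicitFunction _ hinv, ?_, ?_⟩
  · have := hfa.eventually_apply_implicitFunction (by simp) hinv
    simpa only [h0] using this
  · have := hfa.eventually_apply_eq_iff_implicitFunction (by simp) hinv
    filter_upwards [this] with v hv h
    exact hv.1 (h.trans h0.symm)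

lemma pf_wnorm (y : PFE) (x : ℕ → ℝ) (h : ∀ l : ℕ, 1 ≤ l → x l = (l : ℝ)⁻¹ * y l) :
    MemL2w x ∧ wnorm x ≤ 2 * ‖y‖ := by
  have hs := pf_hasSum_norm y
  have hs1 : Summable (fun l : ℕ => |y (l + 1)|) := (summable_nat_add_iff 1).2 hs.summable
  have hb : ∀ l : ℕ, (1 + ((l + 1 : ℕ) : ℝ) ^ 2) * x (l + 1) ^ 2 ≤ (2 * ‖y‖) * |y (l + 1)| := by
    intro l
    rw [h (l + 1) (by omega)]
    have hm : (1 : ℝ) ≤ ((l + 1 : ℕ) : ℝ) := by exact_mod_cast Nat.le_add_left 1 l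
    generalize ((l + 1 : ℕ) : ℝ) = m at hm
    have h1 : |y (l + 1)| ≤ ‖y‖ := lp.norm_apply_le_norm (by simp) y (l + 1)
    have h2 : (1 + m ^ 2) * (m⁻¹ * y (l + 1)) ^ 2 ≤ 2 * y (l + 1) ^ 2 := by
      have : (1 + m ^ 2) * (m⁻¹ * y (l + 1)) ^ 2 = ((m ^ 2)⁻¹ + 1) * y (l + 1) ^ 2 := by
        field_simp
      rw [this]
      have : (m ^ 2)⁻¹ ≤ 1 := inv_le_one_of_one_le₀ (by nlinarith)
      nlinarith [sq_nonneg (y (l + 1))]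
    rw [← sq_abs (y (l + 1))] at h2
    nlinarith [abs_nonneg (y (l + 1))]
  have hmem : MemL2w x := Summable.of_nonneg_of_le (fun l => by positivity) hb (hs1.mul_left _)
  refine ⟨hmem, ?_⟩
  have h1 : wnormSq x ≤ 2 * ‖y‖ * ‖y‖ := by
    refine (hmem.tsum_le_tsum hb (hs1.mul_left _)).trans ?_
    rw [tsum_mul_left]
    gcongr
    rw [← hs.tsum_eq]
    rw [hs.summable.tsum_eq_zero_add]
    linarith [abs_nonneg (y 0)]
  unfold wnorm
  apply Real.sqrt_le_iff.2
  exact ⟨by positivity, by nlinarith [norm_nonneg y]⟩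

lemma pf_l1 : ∃ K : ℝ, 0 < K ∧ ∀ x : ℕ → ℝ, MemL2w x → 0 < wnorm x →
    ∃ X : PFE, X 0 = 0 ∧ (∀ l, 1 ≤ l → X l = x l) ∧ ‖X‖ ≤ K * wnorm x := by
  have hS : Summable (fun l : ℕ => (((l + 1 : ℕ) : ℝ) ^ 2)⁻¹) :=
    (summable_nat_add_iff 1).2 (Real.summable_nat_pow_inv.2 (by norm_num : 1 < 2))
  set S := ∑' l : ℕ, (((l + 1 : ℕ) : ℝ) ^ 2)⁻¹ with hSd
  have hS0 : 0 ≤ S := tsum_nonneg fun l => by positivity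
  refine ⟨1 + S, by linarith, fun x hx hW => ?_⟩
  set W := wnorm x with hWd
  have hWsq : W ^ 2 = ∑' l : ℕ, (1 + ((l + 1 : ℕ) : ℝ) ^ 2) * x (l + 1) ^ 2 := by
    rw [hWd, wnorm, wnormSq, Real.sq_sqrt (tsum_nonneg fun l => by positivity)]
  have hb : ∀ l : ℕ, |x (l + 1)| ≤ W⁻¹ * ((1 + ((l + 1 : ℕ) : ℝ) ^ 2) * x (l + 1) ^ 2) +
      W * (((l + 1 : ℕ) : ℝ) ^ 2)⁻¹ := by
    intro l
    have hm : (0 : ℝ) < ((l + 1 : ℕ) : ℝ) := by positivity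
    generalize ((l + 1 : ℕ) : ℝ) = m at hm
    rw [← sq_abs (x (l + 1))]
    have ht := abs_nonneg (x (l + 1))
    generalize |x (l + 1)| = t at ht
    have h1 : W⁻¹ * ((1 + m ^ 2) * t ^ 2) + W * (m ^ 2)⁻¹ - t =
        W⁻¹ * t ^ 2 + W⁻¹ * (m ^ 2)⁻¹ * ((m ^ 2 * t - W) ^ 2 + W * (m ^ 2 * t)) := by
      field_simp
      ring
    have h2 : 0 ≤ W⁻¹ * t ^ 2 + W⁻¹ * (m ^ 2)⁻¹ * ((m ^ 2 * t - W) ^ 2 + W * (m ^ 2 * t)) := by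
      positivity
    linarith
  have hsr := (hx.mul_left W⁻¹).add (hS.mul_left W)
  have hs1 : Summable (fun l : ℕ => |x (l + 1)|) :=
    Summable.of_nonneg_of_le (fun _ => abs_nonneg _) hb hsr
  obtain ⟨X, hX⟩ := pf_mk (fun l => if l = 0 then 0 else x l)
    ((summable_nat_add_iff 1).1 (by simpa using hs1))
  refine ⟨X, by simp [hX], fun l hl => by rw [hX, if_neg (by omega)], ?_⟩
  rw [← (pf_hasSum_norm X).tsum_eq, (pf_hasSum_norm X).summable.tsum_eq_zero_add]
  have : ∀ l, |X (l + 1)| = |x (l + 1)| := fun l => by rw [hX, if_neg (by omega)]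
  simp only [this]
  rw [hX, if_pos rfl, abs_zero, zero_add]
  refine (hs1.tsum_le_tsum hb hsr).trans ?_
  rw [(hx.mul_left W⁻¹).tsum_add (hS.mul_left W), tsum_mul_left, tsum_mul_left, ← hWsq]
  have : W⁻¹ * W ^ 2 = W := by field_simp
  rw [this, ← hSd]
  linarith

lemma pf_solves (a : ℕ → ℝ) (Q : PFE →L[ℝ] PFE →L[ℝ] PFE)
    (hQ : ∀ x y : PFE, x 0 = 0 → y 0 = 0 → ∀ l : ℕ, 1 ≤ l →
        Summable (fun k : ℕ => (((l + k + 1 : ℕ) : ℝ) * a (l + k + 1)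
          - ((k + 1 : ℕ) : ℝ) * a (k + 1)) * x (l + k + 1) * y (k + 1)) ∧
        Q x y l = ∑ j ∈ Finset.Ico 1 l, (j : ℝ) * a j * x j * y (l - j)
          + ∑' k : ℕ, (((l + k + 1 : ℕ) : ℝ) * a (l + k + 1)
          - ((k + 1 : ℕ) : ℝ) * a (k + 1)) * x (l + k + 1) * y (k + 1))
    (κ : ℝ) (x : ℕ → ℝ) (X : PFE) (hX0 : X 0 = 0) (hX : ∀ l : ℕ, 1 ≤ l → X l = x l) :
    SolvesMV a κ x ↔ ∀ l : ℕ, 1 ≤ l → (l : ℝ) * (2 - κ * a l) * X l = κ * Q X X l := by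
  unfold SolvesMV
  refine forall_congr' fun l => forall_congr' fun hl => ?_
  obtain ⟨h1, h2⟩ := hQ X X hX0 hX0 l hl
  have e1 : (fun k : ℕ => (((l + k + 1 : ℕ) : ℝ) * a (l + k + 1)
          - ((k + 1 : ℕ) : ℝ) * a (k + 1)) * X (l + k + 1) * X (k + 1)) =
      (fun k : ℕ => (((l + k + 1 : ℕ) : ℝ) * a (l + k + 1)
          - ((k + 1 : ℕ) : ℝ) * a (k + 1)) * x (l + k + 1) * x (k + 1)) := by
    ext k
    rw [hX _ (by omega), hX _ (by omega)]
  have e2 : ∑ j ∈ Finset.Ico 1 l, (j : ℝ) * a j * X j * X (l - j) =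
      ∑ j ∈ Finset.Ico 1 l, (j : ℝ) * a j * x j * x (l - j) := by
    refine Finset.sum_congr rfl fun j hj => ?_
    rw [Finset.mem_Ico] at hj
    rw [hX _ (by omega), hX _ (by omega)]
  rw [h2, e1, e2, hX l hl, mul_add]
  rw [e1] at h1
  exact ⟨fun h => h.2, fun h => ⟨h1, h⟩⟩

lemma pf_deriv_contDiffAt {h : ℝ → ℝ} {s : ℝ} (hh : ContDiffAt ℝ 3 h s) :
    ContDiffAt ℝ 2 (deriv h) s := by
  have h1 : ContDiffAt ℝ 2 (fderiv ℝ h) s := hh.fderiv_right (by norm_num)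
  have h2 : deriv h = fun t => fderiv ℝ h t 1 := by ext t; simp
  rw [h2]
  exact h1.clm_apply contDiffAt_const

lemma pf_scalar (k h : ℝ → ℝ) (c : ℝ) (hh : ContDiffAt ℝ 3 h 0)
    (hk : ∀ᶠ s in 𝓝 (0:ℝ), k s = c - s * h s) :
    deriv k 0 = - h 0 ∧ deriv (deriv k) 0 = - (2 * deriv h 0) := by
  have hd : deriv k =ᶠ[𝓝 0] fun s => - (h s + s * deriv h s) := by
    filter_upwards [hk.eventually_nhds, hh.eventually (by simp)] with s hs hs2
    have hs' : k =ᶠ[𝓝 s] fun s => c - s * h s := hs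
    rw [hs'.deriv_eq]
    have h1 : HasDerivAt h (deriv h s) s := (hs2.differentiableAt (by simp)).hasDerivAt
    have h2 := ((hasDerivAt_id s).mul h1).const_sub c
    refine (h2.congr_deriv ?_).deriv
    simp
  refine ⟨by rw [hd.eq_of_nhds]; simp, ?_⟩
  rw [hd.deriv_eq]
  have h1 : HasDerivAt h (deriv h 0) 0 := (hh.differentiableAt (by simp)).hasDerivAt
  have h3 : HasDerivAt (deriv h) (deriv (deriv h) 0) 0 :=
    ((pf_deriv_contDiffAt hh).differentiableAt (by simp)).hasDerivAt
  have h2 := (h1.add ((hasDerivAt_id (0:ℝ)).mul h3)).neg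
  refine (h2.congr_deriv ?_).deriv
  simp
  ring

lemma pf_dinv (α : ℕ → ℝ) (C κ : ℝ) (n : ℕ) (r : ℝ) (hα : ∀ l : ℕ, (l : ℝ) * |α l| ≤ C) :
    ∃ M : ℝ, 0 < M ∧ ∀ l, |((if l = n then r else 2 - κ * α l)⁻¹ : ℝ)| ≤ M := by
  have hα0 : Tendsto α atTop (𝓝 0) := by
    refine squeeze_zero_norm' (a := fun l : ℕ => C / (l : ℝ)) ?_ (tendsto_const_div_atTop_nhds_zero_nat C)
    filter_upwards [eventually_ge_atTop 1] with l hl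
    have : (0:ℝ) < l := by exact_mod_cast hl
    rw [le_div_iff₀ this, mul_comm]
    exact hα l
  have h1 : Tendsto (fun l => (2 - κ * α l)⁻¹) atTop (𝓝 (2⁻¹ : ℝ)) := by
    have h := ((hα0.const_mul κ).const_sub 2)
    simp only [mul_zero, sub_zero] at h
    exact h.inv₀ (by norm_num)
  have h2 : Tendsto (fun l => ((if l = n then r else 2 - κ * α l)⁻¹ : ℝ)) atTop (𝓝 (2⁻¹ : ℝ)) := by
    refine h1.congr' ?_
    filter_upwards [eventually_gt_atTop n] with l hl
    rw [if_neg (by omega)]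
  obtain ⟨M, hM⟩ := (Metric.isBounded_range_of_tendsto _ h2).exists_norm_le
  refine ⟨max M 1, by positivity, fun l => (hM _ ⟨l, rfl⟩).trans (le_max_left _ _)⟩

section generic
variable {E : Type*} [NormedAddCommGroup E] [NormedSpace ℝ E]

lemma pf_smooth (φ : E →L[ℝ] ℝ) (P A T : E →L[ℝ] E) (Q : E →L[ℝ] E →L[ℝ] E) (y0 : E) (κs : ℝ) :
    ContDiff ℝ (⊤ : WithTop ℕ∞) (fun v : ℝ × E => (2:ℝ) • (y0 + P v.2)
    - (κs + φ v.2) • A (y0 + P v.2)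
    - (v.1 * (κs + φ v.2)) • Q (T (y0 + P v.2)) (T (y0 + P v.2))) := by
  have hY : ContDiff ℝ (⊤ : WithTop ℕ∞) (fun v : ℝ × E => y0 + P v.2) :=
    contDiff_const.add (P.contDiff.comp contDiff_snd)
  have hk : ContDiff ℝ (⊤ : WithTop ℕ∞) (fun v : ℝ × E => κs + φ v.2) :=
    contDiff_const.add (φ.contDiff.comp contDiff_snd)
  have hTY : ContDiff ℝ (⊤ : WithTop ℕ∞) (fun v : ℝ × E => T (y0 + P v.2)) := T.contDiff.comp hY
  have hQ : ContDiff ℝ (⊤ : WithTop ℕ∞)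
      (fun v : ℝ × E => Q (T (y0 + P v.2)) (T (y0 + P v.2))) :=
    (Q.contDiff.comp hTY).clm_apply hTY
  have hA : ContDiff ℝ (⊤ : WithTop ℕ∞) (fun v : ℝ × E => A (y0 + P v.2)) := A.contDiff.comp hY
  have h1 := (contDiff_const (c := (2:ℝ))).smul hY
  have h2 := hk.smul hA
  have h3 := (contDiff_fst.mul hk).smul hQ
  exact (h1.sub h2).sub h3

lemma pf_fd (φ : E →L[ℝ] ℝ) (D B : E →L[ℝ] E) :
    HasFDerivAt (fun u => D u - φ u • B u) D 0 := by
  have h := (φ.hasFDerivAt (x := 0)).smul (B.hasFDerivAt (x := 0))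
  have h0 : φ 0 • B + φ.smulRight (B 0) = 0 := by
    ext u
    simp
  rw [h0] at h
  have h2 := (D.hasFDerivAt (x := 0)).sub h
  rw [sub_zero] at h2
  exact h2

/-- derivative of `s ↦ Q (T (y0 + P (u s))) (T (y0 + P (u s)))` -/
lemma pf_gderiv (P T : E →L[ℝ] E) (Q : E →L[ℝ] E →L[ℝ] E) (y0 : E) (ψ : E →L[ℝ] ℝ)
    (u : ℝ → E) (u' : E) (s : ℝ) (hu : HasDerivAt u u' s) :
    HasDerivAt (fun s => ψ (Q (T (y0 + P (u s))) (T (y0 + P (u s)))))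
      (ψ (Q (T (P u')) (T (y0 + P (u s))) + Q (T (y0 + P (u s))) (T (P u')))) s := by
  have h1 : HasDerivAt (fun s => T (y0 + P (u s))) (T (P u')) s :=
    T.hasFDerivAt.comp_hasDerivAt s ((P.hasFDerivAt.comp_hasDerivAt s hu).const_add y0)
  have h2 : HasDerivAt (fun s => Q (T (y0 + P (u s)))) (Q (T (P u'))) s :=
    Q.hasFDerivAt.comp_hasDerivAt s h1
  exact ψ.hasFDerivAt.comp_hasDerivAt s (h2.clm_apply h1)

lemma pf_gsmooth (P T : E →L[ℝ] E) (Q : E →L[ℝ] E →L[ℝ] E) (y0 : E) (ψ : E →L[ℝ] ℝ)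
    (u : ℝ → E) (s : ℝ) (hu : ContDiffAt ℝ 3 u s) :
    ContDiffAt ℝ 3 (fun s => ψ (Q (T (y0 + P (u s))) (T (y0 + P (u s))))) s := by
  have h1 : ContDiffAt ℝ 3 (fun s => T (y0 + P (u s))) s :=
    T.contDiff.contDiffAt.comp s (contDiffAt_const.add (P.contDiff.contDiffAt.comp s hu))
  have h2 : ContDiffAt ℝ 3 (fun s => Q (T (y0 + P (u s)))) s :=
    Q.contDiff.contDiffAt.comp s h1
  exact ψ.contDiff.contDiffAt.comp s (h2.clm_apply h1)

lemma pf_clm_contDiffAt {F : Type*} [NormedAddCommGroup F] [NormedSpace ℝ F] (ψ : E →L[ℝ] F)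
    (u : ℝ → E) (s : ℝ) (hu : ContDiffAt ℝ 3 u s) : ContDiffAt ℝ 3 (fun s => ψ (u s)) s :=
  ψ.contDiff.contDiffAt.comp s hu

lemma pf_clm_hasDerivAt {F : Type*} [NormedAddCommGroup F] [NormedSpace ℝ F] (ψ : E →L[ℝ] F)
    (u : ℝ → E) (u' : E) (s : ℝ) (hu : HasDerivAt u u' s) : HasDerivAt (fun s => ψ (u s)) (ψ u') s :=
  ψ.hasFDerivAt.comp_hasDerivAt s hu

/-- continuity along the branch -/
lemma pf_contY (P : E →L[ℝ] E) (y0 : E) (u : ℝ → E) (s : ℝ) (hu : ContDiffAt ℝ 3 u s) :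
    Tendsto (fun t => ‖t • (y0 + P (u t)) - s • (y0 + P (u s))‖) (𝓝 s) (𝓝 0) := by
  have h1 : ContinuousAt u s := hu.continuousAt
  have h2 : ContinuousAt (fun t => t • (y0 + P (u t))) s :=
    continuousAt_id.smul (continuousAt_const.add (P.continuous.continuousAt.comp h1))
  exact tendsto_iff_norm_sub_tendsto_zero.1 h2

lemma pf_tendP (P : E →L[ℝ] E) (u : ℝ → E) (hu : ContDiffAt ℝ 3 u 0) (h0 : u 0 = 0) :
    Tendsto (fun t => 2 * ‖P (u t)‖) (𝓝 0) (𝓝 0) := by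
  have h1 : ContinuousAt u 0 := hu.continuousAt
  have h2 : ContinuousAt (fun t => 2 * ‖P (u t)‖) 0 :=
    continuousAt_const.mul (P.continuous.continuousAt.comp h1).norm
  have h3 := h2.tendsto
  simpa [h0] using h3

lemma pf_Qbound (Q : E →L[ℝ] E →L[ℝ] E) (x : E) : ‖Q x x‖ ≤ ‖Q‖ * ‖x‖ * ‖x‖ :=
  Q.le_opNorm₂ x x

end generic

lemma pf_dom (z : ℕ → ℝ) (q : PFE) (c : ℝ) (h : ∀ l, |z l| ≤ c * |q l|) :
    ∃ Z : PFE, (∀ l, Z l = z l) ∧ ‖Z‖ ≤ c * ‖q‖ := by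
  have h1 := (pf_hasSum_norm q).mul_left c
  obtain ⟨Z, hZ⟩ := pf_mk z (Summable.of_nonneg_of_le (fun _ => abs_nonneg _) h h1.summable)
  refine ⟨Z, hZ, hasSum_le (fun l => ?_) (pf_hasSum_norm Z) h1⟩
  rw [hZ]; exact h l

lemma pf_coord (M C κs κ₀ ε α y q B : ℝ) (hM0 : 0 < M) (hM : |(2 - κs * α)⁻¹| ≤ M)
    (hd : 2 - κs * α ≠ 0) (hα : |α| ≤ C) (hκ : |κ₀ - κs| ≤ ε) (hε : M * ε * C ≤ 1 / 2)
    (hB : |κ₀| ≤ B) (he : (2 - κ₀ * α) * y = κ₀ * q) : |y| ≤ 2 * M * B * |q| := by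
  have hy : y = (2 - κs * α)⁻¹ * (κ₀ * q + (κ₀ - κs) * α * y) := by
    rw [eq_inv_mul_iff_mul_eq₀ hd]; linear_combination he
  have h1 : |y| ≤ M * (B * |q| + ε * C * |y|) := by
    refine (congrArg abs hy).le.trans ?_
    rw [abs_mul]
    refine mul_le_mul hM ?_ (abs_nonneg _) hM0.le
    refine (abs_add_le _ _).trans ?_
    rw [abs_mul, abs_mul, abs_mul]
    have hε0 : 0 ≤ ε := (abs_nonneg _).trans hκ
    gcongr
  have h2 := mul_le_mul_of_nonneg_right hε (abs_nonneg y)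
  nlinarith

lemma pf_eps (C M K R δ ρ : ℝ) (hδ : 0 < δ) (hρ : 0 < ρ) :
    ∃ ε : ℝ, 0 < ε ∧ ε < 1 ∧ M * ε * C < 1 / 2 ∧ R * (K * ε) < 1 / 2 ∧ K * ε < δ ∧
      K * ε < ρ ∧ 2 * R * (K * ε) * 1 + ε < ρ := by
  have key : ∀ (F : ℝ → ℝ) (c : ℝ), Continuous F → F 0 < c → ∀ᶠ ε in 𝓝[>] (0:ℝ), F ε < c :=
    fun F c hF h => (hF.continuousAt.eventually_lt continuousAt_const h).filter_mono nhdsWithin_le_nhds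
  have := ((((((key (fun ε => ε) 1 (by fun_prop) (by norm_num)).and
    (key (fun ε => M * ε * C) (1/2) (by fun_prop) (by norm_num))).and
    (key (fun ε => R * (K * ε)) (1/2) (by fun_prop) (by norm_num))).and
    (key (fun ε => K * ε) δ (by fun_prop) (by simpa))).and
    (key (fun ε => K * ε) ρ (by fun_prop) (by simpa))).and
    (key (fun ε => 2 * R * (K * ε) * 1 + ε) ρ (by fun_prop) (by simpa))).and
    (self_mem_nhdsWithin : Set.Ioi (0:ℝ) ∈ 𝓝[>] (0:ℝ))
  obtain ⟨ε, ⟨⟨⟨⟨⟨h1, h2⟩, h3⟩, h4⟩, h5⟩, h6⟩, h7⟩ := this.exists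
  exact ⟨ε, h7, h1, h2, h3, h4, h5, h6⟩

set_option maxHeartbeats 2000000

/-- Crandall–Rabinowitz pitchfork bifurcation at `κ* = 2/a_{ℓ*}` when `a_{ℓ*} > 0`
is a simple positive Fourier mode: existence of a nontrivial branch `(p(s), κ(s))`, its tangency
to `e_{ℓ*}`, the curvature formula for `κ''(0)`, and local uniqueness. -/
theorem pitchfork_bifurcation
    (a : ℕ → ℝ) (hA : ∃ C : ℝ, ∀ ℓ : ℕ, 1 ≤ ℓ → (ℓ : ℝ) * |a ℓ| ≤ C)
    (lstar : ℕ) (hl : 1 ≤ lstar) (hpos : 0 < a lstar)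
    (huniq : ∀ ℓ : ℕ, 1 ≤ ℓ → ℓ ≠ lstar → a ℓ ≠ a lstar) :
    ∃ δ : ℝ, 0 < δ ∧ ∃ p : ℝ → ℕ → ℝ, ∃ κ κ' κ'' : ℝ → ℝ,
      (∀ ℓ : ℕ, p 0 ℓ = 0) ∧
      (∀ s ∈ Set.Ioo (-δ) δ, MemL2w (p s) ∧ 0 < κ s ∧ SolvesMV a (κ s) (p s)) ∧
      (∀ s ∈ Set.Ioo (-δ) δ, s ≠ 0 → ∃ ℓ : ℕ, 1 ≤ ℓ ∧ p s ℓ ≠ 0) ∧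
      (∀ s₀ ∈ Set.Ioo (-δ) δ,
        Filter.Tendsto (fun s : ℝ => wnorm (fun ℓ => p s ℓ - p s₀ ℓ)) (𝓝 s₀) (𝓝 0)) ∧
      Filter.Tendsto
        (fun s : ℝ => wnorm (fun ℓ => p s ℓ - s * (if ℓ = lstar then 1 else 0)) / |s|)
        (𝓝[≠] (0:ℝ)) (𝓝 0) ∧
      (∀ s ∈ Set.Ioo (-δ) δ, HasDerivAt κ (κ' s) s ∧ HasDerivAt κ' (κ'' s) s) ∧
      κ 0 = 2 / a lstar ∧ κ' 0 = 0 ∧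
      κ'' 0 = (2 / a lstar) * ((a lstar - 2 * a (2 * lstar)) / (a lstar - a (2 * lstar))) ∧
      ∃ ε : ℝ, 0 < ε ∧ ∀ x : ℕ → ℝ, ∀ κ₀ : ℝ, MemL2w x →
        0 < wnorm x → wnorm x < ε → |κ₀ - 2 / a lstar| < ε → SolvesMV a κ₀ x →
        ∃ s ∈ Set.Ioo (-δ) δ, (∀ ℓ : ℕ, 1 ≤ ℓ → x ℓ = p s ℓ) ∧ κ₀ = κ s := by
  obtain ⟨C, hC⟩ := hA
  set n := lstar with hn
  have hn0 : (0:ℝ) < n := by exact_mod_cast hl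
  have hC0 : 0 ≤ C := le_trans (by positivity) (hC 1 le_rfl)
  set κs : ℝ := 2 / a n with hκs
  have hκsa : κs * a n = 2 := by rw [hκs]; field_simp
  have hκs0 : 0 < κs := by positivity
  -- the coefficients, with the unused entry removed
  let α : ℕ → ℝ := fun l => if l = 0 then 0 else a l
  have hα1 : ∀ l, 1 ≤ l → α l = a l := fun l h => if_neg (by omega)
  have hαC : ∀ l : ℕ, (l:ℝ) * |α l| ≤ C := by
    intro l
    by_cases h : l = 0
    · simp [h, hC0]
    · rw [hα1 l (by omega)]; exact hC l (by omega)
  have hαb : ∀ l, |α l| ≤ C := by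
    intro l
    by_cases h : l = 0
    · simp [α, h, hC0]
    · have h1 : (1:ℝ) ≤ l := by exact_mod_cast Nat.one_le_iff_ne_zero.2 h
      nlinarith [hαC l, abs_nonneg (α l)]
  have hcb : ∀ j : ℕ, |(j:ℝ) * a j| ≤ C := by
    intro j
    by_cases h : j = 0
    · simp [h, hC0]
    · rw [abs_mul, Nat.abs_cast]; exact hC j (by omega)
  obtain ⟨A, hAc, hAn⟩ := pf_diag α C hαb
  obtain ⟨T, hT, hTn⟩ := pf_diag (fun l : ℕ => (l:ℝ)⁻¹) 1 (fun l => by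
    rw [abs_of_nonneg (by positivity)]; exact Nat.cast_inv_le_one l)
  obtain ⟨Q, hQ0, hQs, hQ⟩ := pf_bilin (fun j : ℕ => (j:ℝ) * a j) C hcb
  have hT0 : ∀ y : PFE, T y 0 = 0 := fun y => by rw [hT]; simp
  let e : PFE := lp.single 1 n (1:ℝ)
  have hen : e n = 1 := lp.single_apply_self _ _ _
  have hel : ∀ l, l ≠ n → e l = 0 := fun l h => lp.single_apply_ne _ _ _ h
  have henorm : ‖e‖ = 1 := by
    change ‖(lp.single 1 n (1:ℝ) : PFE)‖ = 1
    rw [lp.norm_single (by simp)]; simp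
  let φ : PFE →L[ℝ] ℝ := lp.evalCLM ℝ (fun _ : ℕ => ℝ) 1 n
  have hφ : ∀ u : PFE, φ u = u n := fun u => rfl
  let P : PFE →L[ℝ] PFE := ContinuousLinearMap.id ℝ PFE - φ.smulRight e
  have hP : ∀ u, P u = u - (u n) • e := fun u => rfl
  have hPn : ∀ u, P u n = 0 := by
    intro u
    rw [hP]
    change u n - u n * e n = 0
    rw [hen]; ring
  have hPl : ∀ u l, l ≠ n → P u l = u l := by
    intro u l h
    rw [hP]
    change u l - u n * e l = u l
    rw [hel l h]; ring
  -- the diagonal derivative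
  let d : ℕ → ℝ := fun l => if l = n then -(n * a n) else 2 - κs * α l
  obtain ⟨M, hM0, hM⟩ := pf_dinv α C κs n (-(n * a n)) hαC
  have hd0 : ∀ l, d l ≠ 0 := by
    intro l
    by_cases h : l = n
    · simp only [d, if_pos h]; exact neg_ne_zero.2 (by positivity)
    · simp only [d, if_neg h]
      by_cases h0 : l = 0
      · simp [α, h0]
      · rw [hα1 l (by omega)]
        intro h2
        apply huniq l (by omega) h
        have : κs * a l = κs * a n := by linarith
        exact mul_left_cancel₀ hκs0.ne' this
  have hdb : ∀ l, |d l| ≤ n * a n + 2 + κs * C := by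
    intro l
    have h1 : 0 < n * a n := by positivity
    by_cases h : l = n
    · simp only [d, if_pos h]
      rw [abs_neg, abs_of_pos h1]; nlinarith
    · simp only [d, if_neg h]
      refine (abs_sub _ _).trans ?_
      rw [abs_mul, abs_of_pos hκs0, abs_two]
      nlinarith [hαb l]
  obtain ⟨D, hD, -⟩ := pf_diag d _ hdb
  obtain ⟨D', hD', -⟩ := pf_diag (fun l => (d l)⁻¹) M hM
  let De : PFE ≃L[ℝ] PFE := ContinuousLinearEquiv.equivOfInverse D D'
    (fun x => by ext l; rw [hD', hD, inv_mul_cancel_left₀ (hd0 l)])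
    (fun x => by ext l; rw [hD, hD', mul_inv_cancel_left₀ (hd0 l)])
  have hDe : (De : PFE →L[ℝ] PFE) = D := rfl
  -- the reduced map
  let Y : PFE → PFE := fun u => (n:ℝ) • e + P u
  have hYn : ∀ u, Y u n = n := by
    intro u
    change n * e n + P u n = n
    rw [hen, hPn]; ring
  have hYl : ∀ u l, l ≠ n → Y u l = u l := by
    intro u l h
    change n * e l + P u l = u l
    rw [hel l h, hPl u l h]; ring
  let f : ℝ × PFE → PFE := fun v => (2:ℝ) • Y v.2 - (κs + φ v.2) • A (Y v.2)
    - (v.1 * (κs + φ v.2)) • Q (T (Y v.2)) (T (Y v.2))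
  have hfl : ∀ s u l, f (s, u) l = (2 - (κs + u n) * α l) * Y u l
      - s * (κs + u n) * Q (T (Y u)) (T (Y u)) l := by
    intro s u l
    change 2 * Y u l - (κs + u n) * A (Y u) l - (s * (κs + u n)) * Q (T (Y u)) (T (Y u)) l = _
    rw [hAc]; ring
  have hf0l : ∀ u, f (0, u) = D u - φ u • A (P u) := by
    intro u
    ext l
    rw [hfl]
    change _ = D u l - u n * A (P u) l
    rw [hD, hAc]
    by_cases h : l = n
    · have hdn : d n = -(n * a n) := if_pos rfl
      rw [h, hPn, hYn, hdn, hα1 _ hl]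
      linear_combination (-(n:ℝ)) * hκsa
    · rw [hPl u l h, hYl u l h]
      simp only [d, if_neg h]
      ring
  have hfsm : ContDiff ℝ (⊤ : WithTop ℕ∞) f := pf_smooth φ P A T Q ((n:ℝ) • e) κs
  have hfD : HasFDerivAt (fun u => f (0, u)) (De : PFE →L[ℝ] PFE) 0 := by
    simp only [hf0l]
    exact pf_fd φ D (A.comp P)
  have hf00 : f (0, 0) = 0 := by rw [hf0l]; simp
  obtain ⟨u, hu0, husm, hueq, huuniq⟩ := pf_ift f hfsm hf00 De hfD
  -- derivative computations at `0`
  let κ : ℝ → ℝ := fun s => κs + φ (u s)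
  have hκn : ∀ s, κ s = κs + u s n := fun s => rfl
  have hTy0 : T ((n:ℝ) • e) = e := by
    ext l
    rw [hT]
    change (l:ℝ)⁻¹ * (n * e l) = e l
    by_cases h : l = n
    · rw [h, hen]; field_simp
    · rw [hel l h]; ring
  have hTY0 : T ((n:ℝ) • e + P (u 0)) = e := by
    rw [hu0, map_zero, add_zero, hTy0]
  let ev : ℕ → PFE →L[ℝ] ℝ := fun l => lp.evalCLM ℝ (fun _ : ℕ => ℝ) 1 l
  have hev : ∀ l (x : PFE), ev l x = x l := fun l x => rfl
  let g : ℕ → ℝ → ℝ := fun l s => ev l (Q (T ((n:ℝ) • e + P (u s))) (T ((n:ℝ) • e + P (u s))))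
  have hg0 : ∀ l, g l 0 = Q e e l := by
    intro l
    simp only [g]
    rw [hTY0, hev]
  have hgsm : ∀ l, ContDiffAt ℝ 3 (g l) 0 := fun l => pf_gsmooth P T Q ((n:ℝ) • e) (ev l) u 0 husm
  have hκsm : ∀ s, ContDiffAt ℝ 3 u s → ContDiffAt ℝ 3 κ s := fun s hs =>
    contDiffAt_const.add (pf_clm_contDiffAt φ u s hs)
  have hκ0 : κ 0 = κs := by
    rw [hκn, hu0]
    change κs + 0 = κs
    ring
  have hu' : HasDerivAt u (deriv u 0) 0 := (husm.differentiableAt (by simp)).hasDerivAt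
  set u' := deriv u 0 with hu'd
  have hcoord : ∀ l, ∀ᶠ s in 𝓝 (0:ℝ), (2 - κ s * α l) * Y (u s) l = s * κ s * g l s := by
    intro l
    filter_upwards [hueq] with s hs
    have := hfl s (u s) l
    rw [hs] at this
    have h0 : (0 : PFE) l = 0 := rfl
    rw [h0] at this
    rw [hκn]
    exact (sub_eq_zero.1 this.symm)
  have hQee : ∀ l, Q e e l = if l = 2 * n then n * a n else 0 := by
    intro l
    have := hQs n n l hl
    change Q e e l = _ at this
    rw [this]
    by_cases h : l = 2 * n
    · rw [if_pos (by omega), if_pos h]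
      simp
    · rw [if_neg (by omega), if_neg h]
      simp
  let h : ℝ → ℝ := fun s => (κ s * g n s) * (n * a n)⁻¹
  have hhsm : ContDiffAt ℝ 3 h 0 := ((hκsm 0 husm).mul (hgsm n)).mul contDiffAt_const
  have hna : (n:ℝ) * a n ≠ 0 := by positivity
  have hκh : ∀ᶠ s in 𝓝 (0:ℝ), κ s = κs - s * h s := by
    filter_upwards [hcoord n] with s hs
    rw [hYn, hα1 n hl] at hs
    simp only [h]
    field_simp
    linear_combination (-1) * hs - (n:ℝ) * hκsa
  obtain ⟨hk1, hk2⟩ := pf_scalar κ h κs hhsm hκh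
  have hgn0 : g n 0 = 0 := by
    rw [hg0, hQee, if_neg (by omega)]
  have hh0 : h 0 = 0 := by simp only [h, hgn0]; ring
  have hκd : HasDerivAt κ (φ u') 0 := (pf_clm_hasDerivAt φ u u' 0 hu').const_add κs
  have hu'n : u' n = 0 := by
    have := hκd.deriv
    rw [hk1, hh0, neg_zero] at this
    exact this.symm
  have hu'l : ∀ l, l ≠ n → (2 - κs * α l) * u' l = κs * Q e e l := by
    intro l hln
    have h1 : HasDerivAt (fun s => (2 - κ s * α l) * ev l (u s))
        ((- (φ u' * α l)) * ev l (u 0) + (2 - κ 0 * α l) * ev l u') 0 :=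
      ((hκd.mul_const (α l)).const_sub 2).mul (pf_clm_hasDerivAt (ev l) u u' 0 hu')
    have h2 : HasDerivAt (fun s => s * κ s * g l s)
        ((1 * κ 0 + 0 * φ u') * g l 0 + 0 * κ 0 * deriv (g l) 0) 0 :=
      ((hasDerivAt_id (0:ℝ)).mul hκd).mul ((hgsm l).differentiableAt (by simp)).hasDerivAt
    have h3 : (fun s => (2 - κ s * α l) * ev l (u s)) =ᶠ[𝓝 0] (fun s => s * κ s * g l s) := by
      filter_upwards [hcoord l] with s hs
      rw [hYl _ l hln] at hs
      exact hs
    have h4 := h1.unique (h2.congr_of_eventuallyEq h3)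
    have h0 : (0 : PFE) l = 0 := rfl
    rw [hκ0, hg0, hu0] at h4
    simp only [hev] at h4
    rw [h0] at h4
    linear_combination h4
  have h2n : (2 - κs * a (2 * n)) ≠ 0 := by
    have := hd0 (2 * n)
    simp only [d] at this
    rwa [if_neg (by omega), hα1 _ (by omega)] at this
  let θ : ℝ := κs * (n * a n) / (2 - κs * a (2 * n))
  let e2 : PFE := lp.single 1 (2 * n) (1:ℝ)
  have he2 : e2 (2 * n) = 1 := lp.single_apply_self _ _ _
  have he2l : ∀ l, l ≠ 2 * n → e2 l = 0 := fun l h => lp.single_apply_ne _ _ _ h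
  have hTPu' : T (P u') = (θ / (2 * n)) • e2 := by
    ext l
    rw [hT]
    change (l:ℝ)⁻¹ * P u' l = θ / (2 * n) * e2 l
    by_cases hln : l = n
    · rw [hln, hPn, he2l _ (by omega)]; ring
    · rw [hPl _ _ hln]
      have h1 := hu'l l hln
      rw [hQee] at h1
      by_cases hl2 : l = 2 * n
      · rw [if_pos hl2] at h1
        subst hl2
        rw [hα1 _ (by omega)] at h1
        have h3 : u' (2 * n) = θ := by
          simp only [θ]
          rw [eq_div_iff h2n]
          linarith
        rw [he2, h3]
        push_cast
        field_simp
      · rw [if_neg hl2, mul_zero] at h1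
        have h3 : (2 - κs * α l) ≠ 0 := by
          have := hd0 l
          simp only [d] at this
          rwa [if_neg hln] at this
        have h4 : u' l = 0 := (mul_eq_zero.1 h1).resolve_left h3
        rw [h4, he2l l hl2]; ring
  have hgd : deriv (g n) 0 = θ / (2 * n) * (2 * n * a (2 * n) - n * a n) := by
    have h1 := (pf_gderiv P T Q ((n:ℝ) • e) (ev n) u u' 0 hu').deriv
    change deriv (g n) 0 = _ at h1
    rw [h1, hTY0, hTPu']
    have h2 : Q ((θ / (2 * n)) • e2) e + Q e ((θ / (2 * n)) • e2) =
        (θ / (2 * n)) • (Q e2 e + Q e e2) := by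
      rw [map_smul, map_smul, smul_add]; rfl
    rw [h2, map_smul, hev]
    change θ / (2 * n) * (Q e2 e n + Q e e2 n) = _
    have h3 := hQs (2 * n) n n hl
    have h4 := hQs n (2 * n) n (by omega)
    change Q e2 e n = _ at h3
    change Q e e2 n = _ at h4
    rw [h3, h4, if_neg (by omega), if_pos (by omega), if_pos (by omega), if_neg (by omega),
      if_neg (by omega)]
    push_cast
    ring
  have hhd : deriv h 0 = κs * (θ / (2 * n) * (2 * n * a (2 * n) - n * a n)) * (n * a n)⁻¹ := by
    have h1 : HasDerivAt h ((φ u' * g n 0 + κ 0 * deriv (g n) 0) * (n * a n)⁻¹) 0 :=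
      (hκd.mul ((hgsm n).differentiableAt (by simp)).hasDerivAt).mul_const _
    rw [h1.deriv, hgn0, hκ0, hgd]; ring
  have hκ2 : deriv (deriv κ) 0 = (2 / a n) * ((a n - 2 * a (2 * n)) / (a n - a (2 * n))) := by
    rw [hk2, hhd]
    have ha2 : a n - a (2 * n) ≠ 0 := sub_ne_zero.2 (huniq (2 * n) (by omega) (by omega)).symm
    have h5 : 2 - κs * a (2 * n) = 2 * (a n - a (2 * n)) / a n := by
      rw [hκs]; field_simp
    simp only [θ]
    rw [h5, hκs]
    field_simp
    ring
  -- choice of `δ`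
  have hκpos : ∀ᶠ s in 𝓝 (0:ℝ), 0 < κ s := by
    have := (hκsm 0 husm).continuousAt.eventually_mem (Ioi_mem_nhds (by rw [hκ0]; exact hκs0 : 0 < κ 0))
    exact this
  obtain ⟨δ, hδ, hδs⟩ := Metric.eventually_nhds_iff.1
    (hueq.and ((husm.eventually (by simp)).and hκpos))
  have hδ' : ∀ s ∈ Set.Ioo (-δ) δ, f (s, u s) = 0 ∧ ContDiffAt ℝ 3 u s ∧ 0 < κ s := by
    intro s hs
    apply hδs
    rw [Real.dist_eq, sub_zero, abs_lt]
    exact hs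
  let p : ℝ → ℕ → ℝ := fun s l => s * T (Y (u s)) l
  have hpX : ∀ s l, p s l = (s • T (Y (u s))) l := fun s l => rfl
  have hpn : ∀ s, p s n = s := by
    intro s
    simp only [p]
    rw [hT, hYn]
    field_simp
  have hsol := pf_solves a Q hQ
  refine ⟨δ, hδ, p, κ, deriv κ, deriv (deriv κ), fun l => by simp [p], ?_, ?_, ?_, ?_, ?_, hκ0,
    by rw [hk1, hh0, neg_zero], hκ2, ?_⟩
  · intro s hs
    obtain ⟨h1, h2, h3⟩ := hδ' s hs
    refine ⟨(pf_wnorm (s • Y (u s)) (p s) fun l _ => ?_).1, h3, ?_⟩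
    · change s * T (Y (u s)) l = _ * (s * Y (u s) l)
      rw [hT]; ring
    · rw [hsol (κ s) (p s) (s • T (Y (u s)))
        (by change s * T (Y (u s)) 0 = 0; rw [hT0, mul_zero]) (fun l _ => rfl)]
      intro l hl1
      have hl0 : (l:ℝ) ≠ 0 := by exact_mod_cast (by omega : l ≠ 0)
      have h4 := hfl s (u s) l
      rw [h1] at h4
      have h0 : (0 : PFE) l = 0 := rfl
      rw [h0, hα1 l hl1] at h4
      have h5 : Q (s • T (Y (u s))) (s • T (Y (u s))) = (s * s) • Q (T (Y (u s))) (T (Y (u s))) := by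
        rw [map_smul, map_smul, mul_smul]; rfl
      rw [h5]
      change l * (2 - κ s * a l) * (s * T (Y (u s)) l) = κ s * (s * s * Q (T (Y (u s))) (T (Y (u s))) l)
      rw [hT, hκn]
      field_simp
      linear_combination (-s) * h4
  · intro s _ hs0
    exact ⟨n, hl, by rw [hpn]; exact hs0⟩
  · intro s₀ hs₀
    have h1 := (pf_contY P ((n:ℝ) • e) u s₀ (hδ' s₀ hs₀).2.1).const_mul 2
    rw [mul_zero] at h1
    refine squeeze_zero (fun s => Real.sqrt_nonneg _) (fun s => ?_) h1
    refine (pf_wnorm (s • Y (u s) - s₀ • Y (u s₀)) _ fun l _ => ?_).2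
    change s * T (Y (u s)) l - s₀ * T (Y (u s₀)) l = _ * (s * Y (u s) l - s₀ * Y (u s₀) l)
    rw [hT, hT]; ring
  · refine squeeze_zero' (Eventually.of_forall fun s => div_nonneg (Real.sqrt_nonneg _) (abs_nonneg _))
      ?_ ((pf_tendP P u husm hu0).mono_left nhdsWithin_le_nhds)
    filter_upwards [self_mem_nhdsWithin] with s hs
    have hs0 : 0 < |s| := abs_pos.2 hs
    rw [div_le_iff₀ hs0]
    have h1 := (pf_wnorm (s • P (u s)) (fun l => p s l - s * (if l = n then 1 else 0)) fun l _ => ?_).2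
    · rw [norm_smul, Real.norm_eq_abs] at h1
      linarith
    · change s * T (Y (u s)) l - _ = _ * (s * P (u s) l)
      rw [hT]
      by_cases hln : l = n
      · rw [if_pos hln, hln, hYn, hPn]; field_simp; ring
      · rw [if_neg hln, hYl _ _ hln, hPl _ _ hln]; ring
  · intro s hs
    have h1 := hκsm s (hδ' s hs).2.1
    exact ⟨(h1.differentiableAt (by simp)).hasDerivAt,
      ((pf_deriv_contDiffAt h1).differentiableAt (by simp)).hasDerivAt⟩
  · obtain ⟨ρ, hρ, hρu⟩ := Metric.eventually_nhds_iff.1 huuniq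
    obtain ⟨K, hK, hKx⟩ := pf_l1
    set R : ℝ := 2 * M * (κs + 1) * ‖Q‖ with hR
    have hR0 : 0 ≤ R := by positivity
    obtain ⟨ε, hε0, hε1, hεC, hεR, hεδ, hερ, hε2⟩ := pf_eps C M K R δ ρ hδ hρ
    refine ⟨ε, hε0, fun x κ₀ hxm hx0 hxε hκε hxs => ?_⟩
    obtain ⟨X, hX0, hXx, hXn⟩ := hKx x hxm hx0
    have hXη : ‖X‖ ≤ K * ε := hXn.trans (by gcongr)
    have hκB : |κ₀| ≤ κs + 1 := by
      have h1 := abs_lt.1 hκε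
      rw [abs_le]; constructor <;> linarith
    have heq := (hsol κ₀ x X hX0 hXx).1 hxs
    have hzb : ∀ l : ℕ, |(if l = n then 0 else (l:ℝ) * X l)| ≤ 2 * M * (κs + 1) * |Q X X l| := by
      intro l
      by_cases hln : l = n
      · rw [if_pos hln, abs_zero]; positivity
      · rw [if_neg hln]
        by_cases hl0 : l = 0
        · simp only [hl0, Nat.cast_zero, zero_mul, abs_zero]; positivity
        · have h1 := hM l
          have h2 := hd0 l
          simp only [d] at h2
          rw [if_neg hln] at h1 h2
          refine pf_coord M C κs κ₀ ε (α l) _ _ _ hM0 h1 h2 (hαb l) hκε.le hεC.le hκB ?_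
          rw [hα1 l (by omega)]
          linear_combination heq l (by omega)
    obtain ⟨Z, hZ, hZn⟩ := pf_dom _ (Q X X) _ hzb
    have hZnn : Z n = 0 := by rw [hZ, if_pos rfl]
    have hZl : ∀ l, l ≠ n → Z l = l * X l := fun l h => by rw [hZ, if_neg h]
    set s : ℝ := X n with hs
    have hXdec : X = s • e + T Z := by
      ext l
      change X l = s * e l + T Z l
      rw [hT]
      by_cases hln : l = n
      · rw [hln, hZnn, hen]; ring
      · rw [hel l hln, hZl l hln]
        by_cases hl0 : l = 0
        · rw [hl0, hX0]; ring
        · have : (l:ℝ) ≠ 0 := by exact_mod_cast hl0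
          field_simp; ring
    have hZR : ‖Z‖ ≤ R * ‖X‖ * ‖X‖ := by
      refine hZn.trans ?_
      have h1 := mul_le_mul_of_nonneg_left (pf_Qbound Q X) (by positivity : 0 ≤ 2 * M * (κs + 1))
      rw [hR]; linarith
    have hXs : ‖X‖ ≤ |s| + ‖Z‖ := by
      have h1 : ‖s • e + T Z‖ ≤ |s| + ‖Z‖ := by
        refine (norm_add_le _ _).trans ?_
        rw [norm_smul, henorm, mul_one, Real.norm_eq_abs]
        have := T.le_of_opNorm_le hTn Z
        linarith
      rw [← hXdec] at h1
      exact h1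
    have hZs : ‖Z‖ ≤ 2 * R * (K * ε) * |s| := by
      have h1 : R * ‖X‖ * ‖X‖ ≤ R * (K * ε) * (|s| + ‖Z‖) := by gcongr
      have h2 := mul_le_mul_of_nonneg_right hεR.le (norm_nonneg Z)
      nlinarith
    have hs0 : s ≠ 0 := by
      intro h0
      rw [h0, abs_zero] at hZs hXs
      have hZ0 : ‖Z‖ = 0 := le_antisymm (by linarith) (norm_nonneg _)
      have hX00 : X = 0 := norm_eq_zero.1 (le_antisymm (by linarith) (norm_nonneg _))
      have h1 := (pf_wnorm 0 x fun l hl1 => by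
        rw [← hXx l hl1, hX00]
        change (0:ℝ) = _ * 0
        ring).2
      rw [norm_zero] at h1
      linarith
    have hsX : |s| ≤ ‖X‖ := by
      have := lp.norm_apply_le_norm (p := 1) (by simp) X n
      simpa using this
    set v : PFE := s⁻¹ • Z + (κ₀ - κs) • e with hv
    have hvl : ∀ l, v l = s⁻¹ * Z l + (κ₀ - κs) * e l := fun l => rfl
    have hvn : v n = κ₀ - κs := by rw [hvl, hZnn, hen]; ring
    have hYv : ∀ l, 1 ≤ l → Y v l = s⁻¹ * (l * X l) := by
      intro l hl1
      by_cases hln : l = n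
      · rw [hln, hYn, ← hs]; field_simp
      · rw [hYl v l hln, hvl, hel l hln, hZl l hln]; ring
    have hY0 : Y v 0 = 0 := by
      rw [hYl v 0 (by omega), hvl, hel 0 (by omega), hZl 0 (by omega), hX0]; ring
    have hTY : T (Y v) = s⁻¹ • X := by
      ext l
      rw [hT]
      change _ = s⁻¹ * X l
      by_cases hl0 : l = 0
      · rw [hl0, hY0, hX0]; ring
      · have : (l:ℝ) ≠ 0 := by exact_mod_cast hl0
        rw [hYv l (by omega)]; field_simp
    have hfv : f (s, v) = 0 := by
      ext l
      rw [hfl, hTY, hvn]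
      change _ = (0:ℝ)
      have h5 : Q (s⁻¹ • X) (s⁻¹ • X) = (s⁻¹ * s⁻¹) • Q X X := by
        rw [map_smul, map_smul, mul_smul]; rfl
      rw [h5]
      change _ - _ * (s⁻¹ * s⁻¹ * Q X X l) = _
      by_cases hl0 : l = 0
      · rw [hl0, hY0, hQ0]; ring
      · rw [hYv l (by omega), hα1 l (by omega)]
        have := heq l (by omega)
        field_simp
        linear_combination this
    have hvnorm : ‖v‖ ≤ 2 * R * (K * ε) * 1 + ε := by
      refine (norm_add_le _ _).trans ?_
      rw [norm_smul, norm_smul, henorm, mul_one, Real.norm_eq_abs, Real.norm_eq_abs, abs_inv]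
      have h1 : |s|⁻¹ * ‖Z‖ ≤ 2 * R * (K * ε) := by
        rw [inv_mul_le_iff₀ (abs_pos.2 hs0)]; linarith
      have h2 : |κ₀ - κs| < ε := hκε
      linarith
    have hus : u s = v := by
      refine hρu (y := (s, v)) ?_ hfv
      rw [Prod.dist_eq, max_lt_iff]
      constructor
      · change dist s 0 < ρ
        rw [Real.dist_eq, sub_zero]; linarith
      · change dist v 0 < ρ
        rw [dist_zero_right]; linarith
    refine ⟨s, abs_lt.1 (by linarith), fun l hl1 => ?_, ?_⟩
    · change x l = s * T (Y (u s)) l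
      rw [hus, hTY, ← hXx l hl1]
      change X l = s * (s⁻¹ * X l)
      field_simp
    · rw [hκn, hus, hvn]; ring
end
end

section
/- Assume sup_{ℓ≥1} ℓ|a_ℓ| < ∞. Let S ⊂ ℕ≥1 be a finite nonempty set and a > 0 be such that a_ℓ = a for all ℓ ∈ S and a_ℓ ≠ a for all ℓ ∉ S. Then there exist η > 0, δ > 0 and C > 0 such that for every κ with |κ − 2/a| < δ and every x ∈ ℓ²_w with ‖x‖_w ≤ η solving the stationary Fourier system at κ, one has ‖w‖_w ≤ C ‖u‖_w², where u is the sequence equal to x on the indices in S and 0 elsewhere, and w := x − u. -/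
open scoped BigOperators
open Filter Topology Real

noncomputable section

lemma finite_gap (a : ℕ → ℝ) (aval : ℝ) (P : ℕ → Prop)
    (h : ∀ ℓ, P ℓ → a ℓ ≠ aval) (N : ℕ) :
    ∃ d : ℝ, 0 < d ∧ ∀ ℓ, ℓ < N → P ℓ → d ≤ |a ℓ - aval| := by
  induction N with
  | zero => exact ⟨1, one_pos, fun ℓ hl => absurd hl (Nat.not_lt_zero _)⟩
  | succ n ih =>
    obtain ⟨d, hd, hb⟩ := ih
    by_cases hP : P n
    · have h0 : 0 < |a n - aval| := abs_pos.mpr (sub_ne_zero.mpr (h n hP))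
      refine ⟨min d |a n - aval|, lt_min hd h0, fun ℓ hl hp => ?_⟩
      rcases Nat.lt_succ_iff_lt_or_eq.mp hl with h1 | h1
      · exact (min_le_left _ _).trans (hb ℓ h1 hp)
      · subst h1; exact min_le_right _ _
    · refine ⟨d, hd, fun ℓ hl hp => ?_⟩
      rcases Nat.lt_succ_iff_lt_or_eq.mp hl with h1 | h1
      · exact hb ℓ h1 hp
      · subst h1; exact absurd hp hP

lemma gap (a : ℕ → ℝ) (A : ℝ) (hA : ∀ ℓ : ℕ, 1 ≤ ℓ → (ℓ : ℝ) * |a ℓ| ≤ A)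
    (aval : ℝ) (hav : 0 < aval) (P : ℕ → Prop)
    (h : ∀ ℓ, P ℓ → a ℓ ≠ aval) :
    ∃ d : ℝ, 0 < d ∧ ∀ ℓ, 1 ≤ ℓ → P ℓ → d ≤ |a ℓ - aval| := by
  obtain ⟨N, hN⟩ := exists_nat_gt (2 * A / aval)
  obtain ⟨d, hd, hb⟩ := finite_gap a aval P h N
  refine ⟨min d (aval / 2), lt_min hd (by positivity), fun ℓ h1 hp => ?_⟩
  by_cases hl : ℓ < N
  · exact (min_le_left _ _).trans (hb ℓ hl hp)
  · refine (min_le_right _ _).trans ?_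
    have hNl : (N : ℝ) ≤ ℓ := by exact_mod_cast not_lt.mp hl
    have hlt : 2 * A < ℓ * aval := (div_lt_iff₀ hav).mp (hN.trans_le hNl)
    have hl0 : (0 : ℝ) < ℓ := by exact_mod_cast h1
    have h3 := hA ℓ h1
    have h4 : |a ℓ| ≤ aval / 2 := by
      by_contra hc
      push Not at hc
      nlinarith
    have h5 := le_abs_self (a ℓ)
    have h6 := neg_abs_le (a ℓ - aval)
    linarith

lemma prod_bound (m n : ℝ) (p r : ℝ) :
    m * |p| * |r| ≤ ((1 + m ^ 2) * p ^ 2 + (1 + n ^ 2) * r ^ 2) / 2 := by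
  have h1 := sq_nonneg (m * |p| - |r|)
  have h2 := sq_abs p
  have h3 := sq_abs r
  nlinarith [sq_nonneg p, sq_nonneg (n * r)]

/-- pointwise bound of the quadratic nonlinearity -/
lemma nonlin_bound (a : ℕ → ℝ) (A : ℝ) (hA : ∀ ℓ : ℕ, 1 ≤ ℓ → (ℓ : ℝ) * |a ℓ| ≤ A)
    (x : ℕ → ℝ) (hx : MemL2w x) (κ : ℝ) (hs : SolvesMV a κ x) (ℓ : ℕ) (hl : 1 ≤ ℓ) :
    (ℓ : ℝ) ^ 2 * |2 - κ * a ℓ| * |x ℓ| ≤ 4 * |κ| * A * wnormSq x := by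
  obtain ⟨hsum, heq⟩ := hs ℓ hl
  have hA0 : 0 ≤ A := le_trans (by positivity) (hA ℓ hl)
  have hb : ∀ j : ℕ, 1 ≤ j → |(j : ℝ) * a j| ≤ A := fun j hj => by
    rw [abs_mul, Nat.abs_cast]; exact hA j hj
  have hl0 : (0 : ℝ) < ℓ := by exact_mod_cast hl
  set q : ℕ → ℝ := fun j => (1 + (j : ℝ) ^ 2) * x j ^ 2 with hq
  have hq0 : ∀ j, 0 ≤ q j := fun j => by simp only [hq]; positivity
  have hqs : Summable (fun k => q (k + 1)) := hx
  have hQ : wnormSq x = ∑' k, q (k + 1) := rfl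
  have hqs' : Summable (fun k => q (ℓ + k + 1)) := by
    have := (summable_nat_add_iff ℓ).mpr hqs
    refine this.congr fun k => ?_
    rw [add_comm k ℓ]
  have htail : ∑' k, q (ℓ + k + 1) ≤ wnormSq x := by
    rw [hQ]
    refine Summable.tsum_le_tsum_of_inj (fun k => ℓ + k) (fun i j h => by simpa using h)
      (fun c _ => hq0 _) (fun i => le_rfl) hqs' hqs
  have hfin : ∑ j ∈ Finset.Ico 1 ℓ, q j ≤ wnormSq x := by
    rw [hQ, Finset.sum_Ico_eq_sum_range]
    simp_rw [add_comm 1]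
    exact hqs.sum_le_tsum _ (fun i _ => hq0 _)
  have hfin' : ∑ j ∈ Finset.Ico 1 ℓ, q (ℓ - j) ≤ wnormSq x := by
    refine le_trans (le_of_eq ?_) hfin
    refine Finset.sum_bij' (fun j _ => ℓ - j) (fun j _ => ℓ - j) ?_ ?_ ?_ ?_ ?_
    · intro j hj; simp only [Finset.mem_Ico] at hj ⊢; omega
    · intro j hj; simp only [Finset.mem_Ico] at hj ⊢; omega
    · intro j hj; simp only [Finset.mem_Ico] at hj; omega
    · intro j hj; simp only [Finset.mem_Ico] at hj; omega
    · intro j hj; rfl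
  have h1 : (ℓ : ℝ) * |∑ j ∈ Finset.Ico 1 ℓ, (j : ℝ) * a j * x j * x (ℓ - j)|
      ≤ A * wnormSq x + A * wnormSq x := by
    calc (ℓ : ℝ) * |∑ j ∈ Finset.Ico 1 ℓ, (j : ℝ) * a j * x j * x (ℓ - j)|
        ≤ ℓ * ∑ j ∈ Finset.Ico 1 ℓ, |(j : ℝ) * a j * x j * x (ℓ - j)| :=
          mul_le_mul_of_nonneg_left (Finset.abs_sum_le_sum_abs _ _) hl0.le
      _ = ∑ j ∈ Finset.Ico 1 ℓ, ℓ * |(j : ℝ) * a j * x j * x (ℓ - j)| := Finset.mul_sum _ _ _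
      _ ≤ ∑ j ∈ Finset.Ico 1 ℓ, (A * q j + A * q (ℓ - j)) := by
          refine Finset.sum_le_sum fun j hj => ?_
          simp only [Finset.mem_Ico] at hj
          have e : (ℓ : ℝ) = (j : ℝ) + ((ℓ - j : ℕ) : ℝ) := by
            rw [← Nat.cast_add]; congr 1; omega
          have b1 := prod_bound (j : ℝ) ((ℓ - j : ℕ) : ℝ) (x j) (x (ℓ - j))
          have b2 := prod_bound ((ℓ - j : ℕ) : ℝ) (j : ℝ) (x (ℓ - j)) (x j)
          have b3 : (ℓ : ℝ) * |x j| * |x (ℓ - j)| ≤ q j + q (ℓ - j) := by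
            simp only [hq]; rw [e]; 
            linarith
          calc (ℓ : ℝ) * |(j : ℝ) * a j * x j * x (ℓ - j)|
              = |(j : ℝ) * a j| * ((ℓ : ℝ) * |x j| * |x (ℓ - j)|) := by
                rw [abs_mul _ (x (ℓ - j)), abs_mul _ (x j)]; ring
            _ ≤ A * (q j + q (ℓ - j)) :=
                mul_le_mul (hb j hj.1) b3 (by positivity) hA0
            _ = _ := by ring
      _ = A * ∑ j ∈ Finset.Ico 1 ℓ, q j + A * ∑ j ∈ Finset.Ico 1 ℓ, q (ℓ - j) := by
          rw [Finset.sum_add_distrib, Finset.mul_sum, Finset.mul_sum]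
      _ ≤ _ := by gcongr
  have h2 : (ℓ : ℝ) * |∑' k : ℕ,
            (((ℓ + k + 1 : ℕ) : ℝ) * a (ℓ + k + 1) - ((k + 1 : ℕ) : ℝ) * a (k + 1))
              * x (ℓ + k + 1) * x (k + 1)| ≤ 2 * A * wnormSq x := by
    set f : ℕ → ℝ := fun k => 
            (((ℓ + k + 1 : ℕ) : ℝ) * a (ℓ + k + 1) - ((k + 1 : ℕ) : ℝ) * a (k + 1))
              * x (ℓ + k + 1) * x (k + 1) with hf
    have hfa : Summable (fun k => |f k|) := hsum.abs
    have hgs : Summable (fun k => A * q (ℓ + k + 1) + A * q (k + 1)) :=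
      (hqs'.mul_left A).add (hqs.mul_left A)
    calc (ℓ : ℝ) * |∑' k, f k| ≤ ℓ * ∑' k, |f k| := by
          refine mul_le_mul_of_nonneg_left ?_ hl0.le
          simpa [Real.norm_eq_abs] using norm_tsum_le_tsum_norm (f := f) (by simpa using hfa)
      _ = ∑' k, ℓ * |f k| := tsum_mul_left.symm
      _ ≤ ∑' k, (A * q (ℓ + k + 1) + A * q (k + 1)) := by
          refine Summable.tsum_le_tsum (fun k => ?_) (hfa.mul_left _) hgs
          have b1 := prod_bound ((ℓ + k + 1 : ℕ) : ℝ) ((k + 1 : ℕ) : ℝ) (x (ℓ + k + 1)) (x (k + 1))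
          have b2 : (ℓ : ℝ) * |x (ℓ + k + 1)| * |x (k + 1)|
              ≤ (q (ℓ + k + 1) + q (k + 1)) / 2 := by
            refine le_trans ?_ b1
            gcongr
            omega
          have b3 : |((ℓ + k + 1 : ℕ) : ℝ) * a (ℓ + k + 1) - ((k + 1 : ℕ) : ℝ) * a (k + 1)|
              ≤ 2 * A := by
            refine (abs_sub _ _).trans ?_
            have := hb (ℓ + k + 1) (by omega)
            have := hb (k + 1) (by omega)
            linarith
          calc (ℓ : ℝ) * |f k|
              = |((ℓ + k + 1 : ℕ) : ℝ) * a (ℓ + k + 1) - ((k + 1 : ℕ) : ℝ) * a (k + 1)|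
                * ((ℓ : ℝ) * |x (ℓ + k + 1)| * |x (k + 1)|) := by
                simp only [hf]
                rw [abs_mul _ (x (k + 1)), abs_mul _ (x (ℓ + k + 1))]; ring
            _ ≤ (2 * A) * ((q (ℓ + k + 1) + q (k + 1)) / 2) :=
                mul_le_mul b3 b2 (by positivity) (by positivity)
            _ = _ := by ring
      _ = A * ∑' k, q (ℓ + k + 1) + A * ∑' k, q (k + 1) := by
          rw [(hqs'.mul_left A).tsum_add (hqs.mul_left A), tsum_mul_left, tsum_mul_left]
      _ ≤ A * wnormSq x + A * wnormSq x := by rw [← hQ]; gcongr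
      _ = _ := by ring
  -- combine: the total constant is 4
  have h3 : (ℓ : ℝ) ^ 2 * |2 - κ * a ℓ| * |x ℓ| = ℓ * |(ℓ : ℝ) * (2 - κ * a ℓ) * x ℓ| := by
    rw [abs_mul, abs_mul, Nat.abs_cast]; ring
  rw [h3, heq, ← mul_add, abs_mul]
  have h4 := mul_le_mul_of_nonneg_left (abs_add_le (∑ j ∈ Finset.Ico 1 ℓ, (j : ℝ) * a j * x j * x (ℓ - j)) (∑' k : ℕ,
            (((ℓ + k + 1 : ℕ) : ℝ) * a (ℓ + k + 1) - ((k + 1 : ℕ) : ℝ) * a (k + 1))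
              * x (ℓ + k + 1) * x (k + 1))) hl0.le
  rw [mul_add] at h4
  have h5 := mul_le_mul_of_nonneg_left (h4.trans (add_le_add h1 h2)) (abs_nonneg κ)
  linarith

set_option maxHeartbeats 2000000 in
/-- quadratic control of the non-dominant modes. If `a_ℓ = a` exactly for
`ℓ ∈ S` (finite nonempty, `S ⊂ ℕ≥1`), then close to `κ = 2/a` every small solution `x`
satisfies `‖w‖_w ≤ C ‖u‖_w²`, where `u = x·1_S` and `w = x − u`. -/
theorem offmode_quadratic_bound
    (a : ℕ → ℝ) (hA : ∃ C : ℝ, ∀ ℓ : ℕ, 1 ≤ ℓ → (ℓ : ℝ) * |a ℓ| ≤ C)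
    (S : Finset ℕ) (hSne : S.Nonempty) (hS1 : ∀ ℓ ∈ S, 1 ≤ ℓ)
    (aval : ℝ) (hav : 0 < aval)
    (hin : ∀ ℓ ∈ S, a ℓ = aval)
    (hout : ∀ ℓ : ℕ, 1 ≤ ℓ → ℓ ∉ S → a ℓ ≠ aval) :
    ∃ η : ℝ, 0 < η ∧ ∃ δ : ℝ, 0 < δ ∧ ∃ C : ℝ, 0 < C ∧
      ∀ κ : ℝ, |κ - 2 / aval| < δ →
        ∀ x : ℕ → ℝ, MemL2w x → wnorm x ≤ η → SolvesMV a κ x →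
          wnorm (fun ℓ => x ℓ - (if ℓ ∈ S then x ℓ else 0))
            ≤ C * wnorm (fun ℓ => if ℓ ∈ S then x ℓ else 0) ^ 2 := by
  obtain ⟨A, hA⟩ := hA
  have hA0 : 0 ≤ A := le_trans (by positivity) (hA 1 le_rfl)
  obtain ⟨d, hd, hgap⟩ := gap a A hA aval hav (fun ℓ => 1 ≤ ℓ ∧ ℓ ∉ S)
    (fun ℓ h => hout ℓ h.1 h.2)
  set c : ℝ := d / aval with hc
  have hc0 : 0 < c := by positivity
  set M : ℝ := 4 * (2 / aval + 1) * A / c with hM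
  have hM0 : 0 ≤ M := by positivity
  set g : ℕ → ℝ := fun k => (1 + ((k + 1 : ℕ) : ℝ) ^ 2) * (1 / ((k + 1 : ℕ) : ℝ) ^ 2) ^ 2 with hg
  have hgs : Summable g := by
    have h2 : Summable (fun k : ℕ => 1 / ((k + 1 : ℕ) : ℝ) ^ 2) :=
      (summable_nat_add_iff 1).mpr (Real.summable_one_div_nat_pow.mpr one_lt_two)
    refine Summable.of_nonneg_of_le (fun k => by simp only [hg]; positivity) (fun k => ?_)
      (h2.mul_left 2)
    simp only [hg]
    have hk : (1 : ℝ) ≤ ((k + 1 : ℕ) : ℝ) ^ 2 := by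
      have : (1 : ℝ) ≤ ((k + 1 : ℕ) : ℝ) := by exact_mod_cast Nat.le_add_left 1 k
      exact one_le_pow₀ this
    generalize ((k + 1 : ℕ) : ℝ) ^ 2 = y at hk
    have hy : 0 < y := by linarith
    have : (1 + y) * (1 / y) ^ 2 = (1 + y) / y * (1 / y) := by field_simp
    rw [this]
    refine mul_le_mul_of_nonneg_right ?_ (by positivity)
    rw [div_le_iff₀ hy]; linarith
  set T : ℝ := ∑' k, g k with hT
  have hT0 : 0 ≤ T := tsum_nonneg fun k => by simp only [hg]; positivity
  set B : ℝ := M * √T with hB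
  have hB0 : 0 ≤ B := by positivity
  refine ⟨1 / (2 * (B + 1)), by positivity, min 1 (d / (aval * (A + 1))), by positivity,
    2 * B + 1, by positivity, ?_⟩
  intro κ hκ x hx hxη hs
  have hκ1 : |κ - 2 / aval| < 1 := hκ.trans_le (min_le_left _ _)
  have hκ2 : |κ - 2 / aval| < d / (aval * (A + 1)) := hκ.trans_le (min_le_right _ _)
  have hκb : |κ| ≤ 2 / aval + 1 := by
    have h1 := abs_add_le (κ - 2 / aval) (2 / aval)
    rw [sub_add_cancel, abs_of_pos (show 0 < 2 / aval by positivity)] at h1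
    linarith
  have hQ0 : 0 ≤ wnormSq x := tsum_nonneg fun k => by positivity
  have hpt : ∀ ℓ : ℕ, 1 ≤ ℓ → ℓ ∉ S → |x ℓ| ≤ M * wnormSq x * (1 / (ℓ : ℝ) ^ 2) := by
    intro ℓ hl hlS
    have hl1 : (1 : ℝ) ≤ ℓ := by exact_mod_cast hl
    have hal : |a ℓ| ≤ A := by
      have := hA ℓ hl
      nlinarith [abs_nonneg (a ℓ)]
    have hcl : c ≤ |2 - κ * a ℓ| := by
      have e : 2 - κ * a ℓ = 2 / aval * (aval - a ℓ) - (κ - 2 / aval) * a ℓ := by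
        field_simp; ring
      have h1 := abs_sub_abs_le_abs_sub (2 / aval * (aval - a ℓ)) ((κ - 2 / aval) * a ℓ)
      rw [← e, abs_mul, abs_mul, abs_of_pos (show 0 < 2 / aval by positivity),
        abs_sub_comm aval] at h1
      have h2 := hgap ℓ hl ⟨hl, hlS⟩
      have h3 : 2 / aval * d ≤ 2 / aval * |a ℓ - aval| := by gcongr
      have h4 : |κ - 2 / aval| * |a ℓ| ≤ d / (aval * (A + 1)) * (A + 1) := by
        gcongr; linarith
      have h5 : d / (aval * (A + 1)) * (A + 1) = c := by rw [hc]; field_simp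
      have h6 : 2 / aval * d = 2 * c := by rw [hc]; ring
      linarith
    have h := nonlin_bound a A hA x hx κ hs ℓ hl
    have h7 : (ℓ : ℝ) ^ 2 * c * |x ℓ| ≤ 4 * (2 / aval + 1) * A * wnormSq x := by
      refine le_trans ?_ (h.trans ?_) <;> gcongr
    have e : M * wnormSq x * (1 / (ℓ : ℝ) ^ 2)
        = (4 * (2 / aval + 1) * A * wnormSq x) / ((ℓ : ℝ) ^ 2 * c) := by
      rw [hM]; field_simp
    rw [e, le_div_iff₀ (by positivity)]
    linarith
  set u : ℕ → ℝ := fun ℓ => if ℓ ∈ S then x ℓ else 0 with hu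
  set w : ℕ → ℝ := fun ℓ => x ℓ - (if ℓ ∈ S then x ℓ else 0) with hw
  have hsplit : ∀ ℓ, x ℓ ^ 2 = u ℓ ^ 2 + w ℓ ^ 2 := by
    intro ℓ
    by_cases h : ℓ ∈ S <;> simp [hu, hw, h]
  have hus : MemL2w u := by
    refine Summable.of_nonneg_of_le (fun k => by positivity) (fun k => ?_) hx
    have := hsplit (k + 1)
    gcongr (1 + _) * ?_
    nlinarith [sq_nonneg (w (k + 1))]
  have hws : MemL2w w := by
    refine Summable.of_nonneg_of_le (fun k => by positivity) (fun k => ?_) hx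
    have := hsplit (k + 1)
    gcongr (1 + _) * ?_
    nlinarith [sq_nonneg (u (k + 1))]
  have hQ : wnormSq x = wnormSq u + wnormSq w := by
    unfold wnormSq
    rw [← Summable.tsum_add hus hws]
    refine tsum_congr fun k => ?_
    rw [hsplit]; ring
  have hU0 : 0 ≤ wnormSq u := tsum_nonneg fun k => by positivity
  have hV0 : 0 ≤ wnormSq w := tsum_nonneg fun k => by positivity
  have hV : wnormSq w ≤ (M * wnormSq x) ^ 2 * T := by
    rw [hT, ← tsum_mul_left]
    refine Summable.tsum_le_tsum (fun k => ?_) hws (hgs.mul_left _)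
    have hwk : |w (k + 1)| ≤ M * wnormSq x * (1 / ((k + 1 : ℕ) : ℝ) ^ 2) := by
      by_cases h : k + 1 ∈ S
      · have : w (k + 1) = 0 := by simp [hw, h]
        rw [this, abs_zero]; positivity
      · have : w (k + 1) = x (k + 1) := by simp [hw, h]
        rw [this]; exact hpt (k + 1) (by omega) h
    have h1 := pow_le_pow_left₀ (abs_nonneg _) hwk 2
    rw [sq_abs, mul_pow] at h1
    have h2 := mul_le_mul_of_nonneg_left h1
      (show (0 : ℝ) ≤ 1 + ((k + 1 : ℕ) : ℝ) ^ 2 by positivity)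
    simp only [hg]
    linarith
  have hsq : wnorm w ≤ B * (wnormSq u + wnormSq w) := by
    unfold wnorm
    refine (Real.sqrt_le_sqrt hV).trans (le_of_eq ?_)
    rw [Real.sqrt_mul (sq_nonneg _), Real.sqrt_sq (by positivity), hQ, hB]; ring
  have hwη : wnorm w ≤ 1 / (2 * (B + 1)) :=
    (Real.sqrt_le_sqrt (by linarith)).trans hxη
  have hw0 : 0 ≤ wnorm w := Real.sqrt_nonneg _
  have hw2 : wnormSq w = wnorm w ^ 2 := (Real.sq_sqrt hV0).symm
  have hu2 : wnormSq u = wnorm u ^ 2 := (Real.sq_sqrt hU0).symm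
  rw [hw2, hu2] at hsq
  rw [le_div_iff₀ (by positivity)] at hwη
  nlinarith [mul_le_mul_of_nonneg_left hwη hw0, sq_nonneg (wnorm u), sq_nonneg (wnorm w)]
end
end

section
/- Assume the no-resonance hypotheses: sup_{ℓ≥1} ℓ|a_ℓ| < ∞, and there are a > 0, k ≥ 1 and Λ = {ℓ₁ < ⋯ < ℓ_k} ⊂ ℕ≥1 with a_j = a for j ∈ Λ and a_j < a for j ∉ Λ, such that for all indices i,j,r,t in {1,…,k} (not necessarily distinct): (i) ℓ_i + ℓ_j ∉ Λ; (ii) ℓ_i + ℓ_j + ℓ_r ∉ Λ; (iii) ℓ_i + ℓ_j = ℓ_r + ℓ_t only if {i,j} = {r,t}. Then there exist η > 0, δ > 0 and C > 0 such that for every κ with |κ − 2/a| ≤ δ, every x ∈ ℓ²_w with ‖x‖_w ≤ η solving the stationary Fourier system at κ, and every l ∈ Λ: |(2 − κa) x_l + B_{ll} x_l³ + ∑_{j ∈ Λ, j ≠ l} B_{lj} x_l x_j²| ≤ C (‖x‖_w⁴ + ‖x‖_w³ |κa − 2|). -/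
open scoped BigOperators
open Filter Topology Real

noncomputable section

/-- `U` bounds the `ℓ²` norm of `u`. -/
def L2b (u : ℕ → ℝ) (U : ℝ) : Prop := 0 ≤ U ∧ ∀ s : Finset ℕ, ∑ n ∈ s, u n ^ 2 ≤ U ^ 2

/-- tail term -/
def tl (a u v : ℕ → ℝ) (ℓ k : ℕ) : ℝ :=
  (((ℓ + k + 1 : ℕ) : ℝ) * a (ℓ + k + 1) - ((k + 1 : ℕ) : ℝ) * a (k + 1))
        * u (ℓ + k + 1) * v (k + 1)

/-- bilinear form -/
def Qb (a u v : ℕ → ℝ) (ℓ : ℕ) : ℝ :=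
  ∑ j ∈ Finset.Ico 1 ℓ, (j : ℝ) * a j * u j * v (ℓ - j) + ∑' k : ℕ, tl a u v ℓ k

/-- unit vector -/
def ev (m n : ℕ) : ℝ := if n = m then 1 else 0

theorem L2b.cs {u v : ℕ → ℝ} {U V : ℝ} (hu : L2b u U) (hv : L2b v V) (s : Finset ℕ)
    (f g : ℕ → ℕ) (hf : Set.InjOn f s) (hg : Set.InjOn g s) :
    ∑ k ∈ s, |u (f k)| * |v (g k)| ≤ U * V := by
  have h1 : ∑ k ∈ s, |u (f k)| ^ 2 ≤ U ^ 2 := by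
    have := hu.2 (s.image f)
    rw [Finset.sum_image hf] at this
    simpa using this
  have h2 : ∑ k ∈ s, |v (g k)| ^ 2 ≤ V ^ 2 := by
    have := hv.2 (s.image g)
    rw [Finset.sum_image hg] at this
    simpa using this
  have h3 := Finset.sum_mul_sq_le_sq_mul_sq s (fun k => |u (f k)|) (fun k => |v (g k)|)
  have h4 : (∑ k ∈ s, |u (f k)| * |v (g k)|) ^ 2 ≤ (U * V) ^ 2 := by
    rw [mul_pow]
    refine h3.trans (mul_le_mul h1 h2 (Finset.sum_nonneg fun _ _ => by positivity) (by positivity))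
  exact le_of_sq_le_sq h4 (mul_nonneg hu.1 hv.1)

theorem tl_abs {a u v : ℕ → ℝ} {A : ℝ} (hA : ∀ n : ℕ, (n : ℝ) * |a n| ≤ A) (ℓ k : ℕ) :
    |tl a u v ℓ k| ≤ 2 * A * (|u (ℓ + k + 1)| * |v (k + 1)|) := by
  unfold tl
  rw [abs_mul, abs_mul, mul_assoc]
  refine mul_le_mul_of_nonneg_right ?_ (by positivity)
  refine (abs_sub _ _).trans ?_
  rw [abs_mul, abs_mul, Nat.abs_cast, Nat.abs_cast]
  linarith [hA (ℓ + k + 1), hA (k + 1)]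

theorem tl_fin {a u v : ℕ → ℝ} {A U V : ℝ} (hA : ∀ n : ℕ, (n : ℝ) * |a n| ≤ A)
    (hu : L2b u U) (hv : L2b v V) (ℓ : ℕ) (s : Finset ℕ) :
    ∑ k ∈ s, |tl a u v ℓ k| ≤ 2 * A * (U * V) := by
  have hA0 : 0 ≤ A := le_trans (by simp) (hA 0)
  calc _ ≤ ∑ k ∈ s, 2 * A * (|u (ℓ + k + 1)| * |v (k + 1)|) :=
        Finset.sum_le_sum fun k _ => tl_abs hA ℓ k
    _ = 2 * A * ∑ k ∈ s, |u (ℓ + k + 1)| * |v (k + 1)| := by rw [Finset.mul_sum]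
    _ ≤ _ := mul_le_mul_of_nonneg_left
        (hu.cs hv s (fun k => ℓ + k + 1) (fun k => k + 1)
          (fun x _ y _ h => by simp only at h; omega)
          (fun x _ y _ h => by simp only at h; omega)) (by positivity)

theorem tl_summable_abs {a u v : ℕ → ℝ} {A U V : ℝ} (hA : ∀ n : ℕ, (n : ℝ) * |a n| ≤ A)
    (hu : L2b u U) (hv : L2b v V) (ℓ : ℕ) : Summable (fun k => |tl a u v ℓ k|) :=
  summable_of_sum_le (fun _ => abs_nonneg _) (tl_fin hA hu hv ℓ)

theorem tl_summable {a u v : ℕ → ℝ} {A U V : ℝ} (hA : ∀ n : ℕ, (n : ℝ) * |a n| ≤ A)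
    (hu : L2b u U) (hv : L2b v V) (ℓ : ℕ) : Summable (fun k => tl a u v ℓ k) :=
  (tl_summable_abs hA hu hv ℓ).of_abs

theorem Qb_bound {a u v : ℕ → ℝ} {A U V : ℝ} (hA : ∀ n : ℕ, (n : ℝ) * |a n| ≤ A)
    (hu : L2b u U) (hv : L2b v V) (ℓ : ℕ) : |Qb a u v ℓ| ≤ 3 * A * (U * V) := by
  have hA0 : 0 ≤ A := le_trans (by simp) (hA 0)
  have h1 : |∑' k : ℕ, tl a u v ℓ k| ≤ 2 * A * (U * V) := by
    have hs := tl_summable_abs hA hu hv ℓ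
    have := norm_tsum_le_tsum_norm (f := fun k => tl a u v ℓ k) (by simpa using hs)
    simp only [Real.norm_eq_abs] at this
    exact this.trans (hs.tsum_le_of_sum_le (tl_fin hA hu hv ℓ))
  have h2 : |∑ j ∈ Finset.Ico 1 ℓ, (j : ℝ) * a j * u j * v (ℓ - j)| ≤ A * (U * V) := by
    calc _ ≤ ∑ j ∈ Finset.Ico 1 ℓ, |(j : ℝ) * a j * u j * v (ℓ - j)| :=
          Finset.abs_sum_le_sum_abs _ _
      _ ≤ ∑ j ∈ Finset.Ico 1 ℓ, A * (|u j| * |v (ℓ - j)|) := by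
          refine Finset.sum_le_sum fun j _ => ?_
          rw [abs_mul, abs_mul, mul_assoc, abs_mul, Nat.abs_cast]
          exact mul_le_mul_of_nonneg_right (hA j) (by positivity)
      _ = A * ∑ j ∈ Finset.Ico 1 ℓ, |u j| * |v (ℓ - j)| := by rw [Finset.mul_sum]
      _ ≤ _ := mul_le_mul_of_nonneg_left
          (hu.cs hv _ (fun j => j) (fun j => ℓ - j) (fun x _ y _ h => h)
            (fun x hx y hy h => by
              simp only [Finset.coe_Ico, Set.mem_Ico] at hx hy h; omega)) hA0
  unfold Qb
  refine (abs_add_le _ _).trans ?_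
  linarith

theorem Qb_add_left {a u u' v : ℕ → ℝ} {A U U' V : ℝ} (hA : ∀ n : ℕ, (n : ℝ) * |a n| ≤ A)
    (hu : L2b u U) (hu' : L2b u' U') (hv : L2b v V) (ℓ : ℕ) :
    Qb a (fun n => u n + u' n) v ℓ = Qb a u v ℓ + Qb a u' v ℓ := by
  unfold Qb
  have : ∀ k, tl a (fun n => u n + u' n) v ℓ k = tl a u v ℓ k + tl a u' v ℓ k := by
    intro k; unfold tl; ring
  simp only [this]
  rw [(tl_summable hA hu hv ℓ).tsum_add (tl_summable hA hu' hv ℓ)]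
  have : ∀ j : ℕ, (j : ℝ) * a j * (u j + u' j) * v (ℓ - j)
    = (j : ℝ) * a j * u j * v (ℓ - j) + (j : ℝ) * a j * u' j * v (ℓ - j) := by intro j; ring
  simp only [this, Finset.sum_add_distrib]
  ring

theorem Qb_add_right {a u v v' : ℕ → ℝ} {A U V V' : ℝ} (hA : ∀ n : ℕ, (n : ℝ) * |a n| ≤ A)
    (hu : L2b u U) (hv : L2b v V) (hv' : L2b v' V') (ℓ : ℕ) :
    Qb a u (fun n => v n + v' n) ℓ = Qb a u v ℓ + Qb a u v' ℓ := by
  unfold Qb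
  have : ∀ k, tl a u (fun n => v n + v' n) ℓ k = tl a u v ℓ k + tl a u v' ℓ k := by
    intro k; unfold tl; ring
  simp only [this]
  rw [(tl_summable hA hu hv ℓ).tsum_add (tl_summable hA hu hv' ℓ)]
  have : ∀ j : ℕ, (j : ℝ) * a j * u j * (v (ℓ - j) + v' (ℓ - j))
    = (j : ℝ) * a j * u j * v (ℓ - j) + (j : ℝ) * a j * u j * v' (ℓ - j) := by intro j; ring
  simp only [this, Finset.sum_add_distrib]
  ring

theorem L2b_ev (m : ℕ) : L2b (ev m) 1 := by
  refine ⟨zero_le_one, fun s => ?_⟩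
  unfold ev
  simp only [ite_pow, one_pow, ne_eq, OfNat.ofNat_ne_zero, not_false_eq_true, zero_pow,
    Finset.sum_ite_eq']
  split_ifs <;> norm_num

theorem Qb_sum_left {a v : ℕ → ℝ} {A V : ℝ} (hA : ∀ n : ℕ, (n : ℝ) * |a n| ≤ A)
    (hv : L2b v V) {k : ℕ} (c : Fin k → ℝ) (l : Fin k → ℕ) (ℓ : ℕ) :
    Qb a (fun n => ∑ i, c i * ev (l i) n) v ℓ = ∑ i, c i * Qb a (ev (l i)) v ℓ := by
  unfold Qb
  have : ∀ k, tl a (fun n => ∑ i, c i * ev (l i) n) v ℓ k = ∑ i, c i * tl a (ev (l i)) v ℓ k := by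
    intro k; unfold tl
    rw [Finset.mul_sum, Finset.sum_mul]
    exact Finset.sum_congr rfl fun i _ => by ring
  simp only [this]
  rw [Summable.tsum_finsetSum (fun i _ => (tl_summable hA (L2b_ev (l i)) hv ℓ).mul_left (c i))]
  have : ∀ j : ℕ, (j : ℝ) * a j * (∑ i, c i * ev (l i) j) * v (ℓ - j)
    = ∑ i, c i * ((j : ℝ) * a j * ev (l i) j * v (ℓ - j)) := by
    intro j
    rw [Finset.mul_sum, Finset.sum_mul]
    exact Finset.sum_congr rfl fun i _ => by ring
  simp only [this, tsum_mul_left, mul_add, Finset.sum_add_distrib]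
  rw [Finset.sum_comm]
  simp only [Finset.mul_sum]

theorem Qb_sum_right {a u : ℕ → ℝ} {A U : ℝ} (hA : ∀ n : ℕ, (n : ℝ) * |a n| ≤ A)
    (hu : L2b u U) {k : ℕ} (c : Fin k → ℝ) (l : Fin k → ℕ) (ℓ : ℕ) :
    Qb a u (fun n => ∑ i, c i * ev (l i) n) ℓ = ∑ i, c i * Qb a u (ev (l i)) ℓ := by
  unfold Qb
  have : ∀ k, tl a u (fun n => ∑ i, c i * ev (l i) n) ℓ k = ∑ i, c i * tl a u (ev (l i)) ℓ k := by
    intro k; unfold tl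
    rw [Finset.mul_sum]
    exact Finset.sum_congr rfl fun i _ => by ring
  simp only [this]
  rw [Summable.tsum_finsetSum (fun i _ => (tl_summable hA hu (L2b_ev (l i)) ℓ).mul_left (c i))]
  have : ∀ j : ℕ, (j : ℝ) * a j * u j * (∑ i, c i * ev (l i) (ℓ - j))
    = ∑ i, c i * ((j : ℝ) * a j * u j * ev (l i) (ℓ - j)) := by
    intro j
    rw [Finset.mul_sum]
    exact Finset.sum_congr rfl fun i _ => by ring
  simp only [this, tsum_mul_left, mul_add, Finset.sum_add_distrib]
  rw [Finset.sum_comm]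
  simp only [Finset.mul_sum]

theorem Qb_ev_left (a v : ℕ → ℝ) (m ℓ : ℕ) (hm : 1 ≤ m) :
    Qb a (ev m) v ℓ = (if m < ℓ then (m : ℝ) * a m * v (ℓ - m) else 0)
      + (if ℓ < m then ((m : ℝ) * a m - ((m - ℓ : ℕ) : ℝ) * a (m - ℓ)) * v (m - ℓ) else 0) := by
  unfold Qb
  congr 1
  · have : ∀ j : ℕ, (j : ℝ) * a j * ev m j * v (ℓ - j)
        = if j = m then (j : ℝ) * a j * v (ℓ - j) else 0 := by
      intro j; unfold ev; split_ifs <;> ring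
    simp only [this, Finset.sum_ite_eq', Finset.mem_Ico, hm, true_and]
  · split_ifs with h
    · rw [tsum_eq_single (m - ℓ - 1)]
      · unfold tl ev
        have h1 : ℓ + (m - ℓ - 1) + 1 = m := by omega
        have h2 : m - ℓ - 1 + 1 = m - ℓ := by omega
        rw [h1, h2]; simp
      · intro b hb
        unfold tl ev
        rw [if_neg (by omega)]; simp
    · have : ∀ k, tl a (ev m) v ℓ k = 0 := by
        intro k; unfold tl ev
        rw [if_neg (by omega)]; simp
      simp [this]

theorem Qb_ev_right (a u : ℕ → ℝ) (m ℓ : ℕ) (hm : 1 ≤ m) :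
    Qb a u (ev m) ℓ = (if m < ℓ then ((ℓ - m : ℕ) : ℝ) * a (ℓ - m) * u (ℓ - m) else 0)
      + (((ℓ + m : ℕ) : ℝ) * a (ℓ + m) - (m : ℝ) * a m) * u (ℓ + m) := by
  unfold Qb
  congr 1
  · split_ifs with h
    · rw [Finset.sum_eq_single (ℓ - m)]
      · unfold ev; rw [if_pos (by omega)]; ring
      · intro b hb hb'
        simp only [Finset.mem_Ico] at hb
        unfold ev; rw [if_neg (by omega)]; ring
      · intro hh; simp only [Finset.mem_Ico] at hh; omega
    · refine Finset.sum_eq_zero fun j hj => ?_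
      simp only [Finset.mem_Ico] at hj
      unfold ev; rw [if_neg (by omega)]; ring
  · rw [tsum_eq_single (m - 1)]
    · unfold tl ev
      have h1 : ℓ + (m - 1) + 1 = ℓ + m := by omega
      have h2 : m - 1 + 1 = m := by omega
      rw [h1, h2]; simp
    · intro b hb
      unfold tl ev
      rw [if_neg (by omega)]; simp

theorem Qb_ev_ev (a : ℕ → ℝ) (m n ℓ : ℕ) (hm : 1 ≤ m) (hn : 1 ≤ n) :
    Qb a (ev m) (ev n) ℓ = (if m + n = ℓ then (m : ℝ) * a m else 0)
      + (if m = ℓ + n then (m : ℝ) * a m - (n : ℝ) * a n else 0) := by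
  rw [Qb_ev_left _ _ _ _ hm]
  unfold ev
  congr 1
  · by_cases h : m + n = ℓ
    · rw [if_pos h, if_pos (by omega), if_pos (by omega)]; ring
    · rw [if_neg h]
      split_ifs <;> first | omega | ring
  · by_cases h : m = ℓ + n
    · rw [if_pos h, if_pos (by omega), if_pos (by omega)]
      have : m - ℓ = n := by omega
      rw [this]; ring
    · rw [if_neg h]
      split_ifs <;> first | omega | ring

/-- explicit cross term -/
def Ec (a w : ℕ → ℝ) (ℓ m : ℕ) : ℝ :=
  (if m < ℓ then (m : ℝ) * a m * w (ℓ - m) else 0)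
      + (if ℓ < m then ((m : ℝ) * a m - ((m - ℓ : ℕ) : ℝ) * a (m - ℓ)) * w (m - ℓ) else 0)
  + ((if m < ℓ then ((ℓ - m : ℕ) : ℝ) * a (ℓ - m) * w (ℓ - m) else 0)
      + (((ℓ + m : ℕ) : ℝ) * a (ℓ + m) - (m : ℝ) * a m) * w (ℓ + m))

theorem Ec_sub (a w w' : ℕ → ℝ) (ℓ m : ℕ) :
    Ec a (fun n => w n - w' n) ℓ m = Ec a w ℓ m - Ec a w' ℓ m := by
  unfold Ec
  split_ifs <;> ring

theorem Ec_bound {a w : ℕ → ℝ} {A D : ℝ} (hA : ∀ n : ℕ, (n : ℝ) * |a n| ≤ A)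
    (hw : ∀ n, |w n| ≤ D) (ℓ m : ℕ) : |Ec a w ℓ m| ≤ 6 * (A * D) := by
  have hA0 : 0 ≤ A := le_trans (by simp) (hA 0)
  have hD0 : 0 ≤ D := (abs_nonneg _).trans (hw 0)
  have hAD : 0 ≤ A * D := mul_nonneg hA0 hD0
  have hA' : ∀ n : ℕ, |(n : ℝ) * a n| ≤ A := by
    intro n; rw [abs_mul, Nat.abs_cast]; exact hA n
  have h1 : ∀ n p : ℕ, |(n : ℝ) * a n * w p| ≤ A * D := by
    intro n p; rw [abs_mul]
    exact mul_le_mul (hA' n) (hw p) (abs_nonneg _) hA0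
  have h2 : ∀ n n' p : ℕ, |((n : ℝ) * a n - (n' : ℝ) * a n') * w p| ≤ 2 * (A * D) := by
    intro n n' p; rw [sub_mul]
    refine (abs_sub _ _).trans ?_
    linarith [h1 n p, h1 n' p]
  unfold Ec
  refine (abs_add_le _ _).trans ?_
  refine (add_le_add (abs_add_le _ _) (abs_add_le _ _)).trans ?_
  have e1 : |if m < ℓ then (m : ℝ) * a m * w (ℓ - m) else 0| ≤ A * D := by
    split_ifs
    · exact h1 _ _
    · simpa using hAD
  have e2 : |if ℓ < m then ((m : ℝ) * a m - ((m - ℓ : ℕ) : ℝ) * a (m - ℓ)) * w (m - ℓ) else 0|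
      ≤ 2 * (A * D) := by
    split_ifs
    · exact h2 _ _ _
    · simpa using hAD
  have e3 : |if m < ℓ then ((ℓ - m : ℕ) : ℝ) * a (ℓ - m) * w (ℓ - m) else 0| ≤ A * D := by
    split_ifs
    · exact h1 _ _
    · simpa using hAD
  have e4 := h2 (ℓ + m) m (ℓ + m)
  linarith

theorem gap_exists (a : ℕ → ℝ) {A : ℝ} (hA : ∀ n : ℕ, (n : ℝ) * |a n| ≤ A)
    (aval : ℝ) (hav : 0 < aval) (P : ℕ → Prop) (hout : ∀ j : ℕ, 1 ≤ j → P j → a j < aval) :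
    ∃ c : ℝ, 0 < c ∧ ∀ j : ℕ, 1 ≤ j → P j → c ≤ aval - a j := by
  obtain ⟨M, hM⟩ := exists_nat_gt (2 * A / aval)
  have key : ∀ M : ℕ, ∃ c : ℝ, 0 < c ∧ ∀ j : ℕ, j < M → 1 ≤ j → P j → c ≤ aval - a j := by
    intro M
    induction M with
    | zero => exact ⟨1, one_pos, fun j hj => by omega⟩
    | succ M ih =>
      obtain ⟨c, hc, h⟩ := ih
      by_cases hP : 1 ≤ M ∧ P M
      · refine ⟨min c (aval - a M), lt_min hc (sub_pos.2 (hout M hP.1 hP.2)), ?_⟩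
        intro j hj h1 h2
        rcases Nat.lt_succ_iff_lt_or_eq.1 hj with h3 | h3
        · exact (min_le_left _ _).trans (h j h3 h1 h2)
        · subst h3; exact min_le_right _ _
      · refine ⟨c, hc, ?_⟩
        intro j hj h1 h2
        rcases Nat.lt_succ_iff_lt_or_eq.1 hj with h3 | h3
        · exact h j h3 h1 h2
        · subst h3; exact absurd ⟨h1, h2⟩ hP
  obtain ⟨c, hc, h⟩ := key M
  refine ⟨min c (aval / 2), lt_min hc (by positivity), ?_⟩
  intro j h1 h2
  by_cases hj : j < M
  · exact (min_le_left _ _).trans (h j hj h1 h2)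
  · refine (min_le_right _ _).trans ?_
    have hjM : (M : ℝ) ≤ j := by exact_mod_cast not_lt.1 hj
    have hj0 : (0 : ℝ) < j := by exact_mod_cast h1
    have h3 := hA j
    have h4 : 2 * A < M * aval := by rwa [div_lt_iff₀ hav] at hM
    have h5 : (j : ℝ) * a j ≤ j * (aval / 2) := by
      have : (j : ℝ) * a j ≤ j * |a j| := mul_le_mul_of_nonneg_left (le_abs_self _) hj0.le
      nlinarith
    have := le_of_mul_le_mul_left h5 hj0
    linarith

/-- dominant part -/
def yp {k : ℕ} (lf : Fin k → ℕ) (x : ℕ → ℝ) (n : ℕ) : ℝ := ∑ i, x (lf i) * ev (lf i) n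

theorem yp_at {k : ℕ} (lf : Fin k → ℕ) (hinj : Function.Injective lf) (x : ℕ → ℝ) (i : Fin k) :
    yp lf x (lf i) = x (lf i) := by
  unfold yp ev
  rw [Finset.sum_eq_single i]
  · simp
  · intro b _ hb
    rw [if_neg (fun h => hb (hinj h.symm))]; simp
  · simp

theorem yp_out {k : ℕ} (lf : Fin k → ℕ) (x : ℕ → ℝ) (n : ℕ) (hn : ∀ i, n ≠ lf i) :
    yp lf x n = 0 := by
  unfold yp ev
  exact Finset.sum_eq_zero fun i _ => by rw [if_neg (hn i)]; simp

theorem Qyy {a : ℕ → ℝ} {A : ℝ} (hA : ∀ n : ℕ, (n : ℝ) * |a n| ≤ A)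
    {aval : ℝ} {k : ℕ} (lf : Fin k → ℕ) (hl1 : ∀ i, 1 ≤ lf i) (hin : ∀ i, a (lf i) = aval)
    (x : ℕ → ℝ) {N : ℝ} (hy : L2b (yp lf x) N) (p : ℕ) :
    Qb a (yp lf x) (yp lf x) p = ∑ r, ∑ t, aval * x (lf r) * x (lf t) *
      ((if lf r + lf t = p then (lf r : ℝ) else 0)
        + (if lf r = p + lf t then (lf r : ℝ) - lf t else 0)) := by
  have h1 : Qb a (yp lf x) (yp lf x) p = ∑ i, x (lf i) * Qb a (ev (lf i)) (yp lf x) p :=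
    Qb_sum_left hA hy (fun i => x (lf i)) lf p
  rw [h1]
  refine Finset.sum_congr rfl fun r _ => ?_
  have h2 : Qb a (ev (lf r)) (yp lf x) p = ∑ i, x (lf i) * Qb a (ev (lf r)) (ev (lf i)) p :=
    Qb_sum_right hA (L2b_ev _) (fun i => x (lf i)) lf p
  rw [h2, Finset.mul_sum]
  refine Finset.sum_congr rfl fun t _ => ?_
  rw [Qb_ev_ev _ _ _ _ (hl1 r) (hl1 t), hin, hin]
  split_ifs <;> ring

theorem pair_eq {α : Type*} [DecidableEq α] {i j r t : α}
    (h : ({i, j} : Finset α) = {r, t}) : (i = r ∧ j = t) ∨ (i = t ∧ j = r) := by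
  have h1 := Finset.ext_iff.1 h
  have e1 := h1 i
  have e2 := h1 j
  have e3 := h1 r
  have e4 := h1 t
  simp only [Finset.mem_insert, Finset.mem_singleton] at e1 e2 e3 e4
  grind

section
variable {k : ℕ} (lf : Fin k → ℕ) (x : ℕ → ℝ) (aval : ℝ)

/-- explicit quadratic form on dominant modes -/
def Qd (p : ℕ) : ℝ := ∑ r, ∑ t, aval * x (lf r) * x (lf t) *
      ((if lf r + lf t = p then (lf r : ℝ) else 0)
        + (if lf r = p + lf t then (lf r : ℝ) - lf t else 0))

theorem Qd_dom (hres1 : ∀ i j t : Fin k, lf i + lf j ≠ lf t) (i : Fin k) :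
    Qd lf x aval (lf i) = 0 := by
  unfold Qd
  refine Finset.sum_eq_zero fun r _ => Finset.sum_eq_zero fun t _ => ?_
  rw [if_neg (hres1 r t i), if_neg (fun h => hres1 i t r h.symm)]; ring

theorem Qd_dbl (hres2 : ∀ i j r t : Fin k, lf i + lf j + lf r ≠ lf t)
    (hres3 : ∀ i j r t : Fin k, lf i + lf j = lf r + lf t →
      ({i, j} : Finset (Fin k)) = {r, t}) (i : Fin k) :
    Qd lf x aval (lf i + lf i) = lf i * aval * x (lf i) ^ 2 := by
  unfold Qd
  rw [Finset.sum_eq_single i, Finset.sum_eq_single i]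
  · rw [if_pos rfl, if_neg (fun h => hres2 i i i i h.symm)]; ring
  · intro t _ ht
    rw [if_neg (fun h => ?_), if_neg (fun h => hres2 i i t i h.symm)]
    · ring
    · rcases pair_eq (hres3 _ _ _ _ h) with h' | h'
      · exact ht h'.2
      · exact ht h'.2
  · simp
  · intro r _ hr
    refine Finset.sum_eq_zero fun t _ => ?_
    rw [if_neg (fun h => ?_), if_neg (fun h => hres2 i i t r h.symm)]
    · ring
    · rcases pair_eq (hres3 _ _ _ _ h) with h' | h'
      · exact hr h'.1
      · exact hr h'.1
  · simp

theorem Qd_add (hres2 : ∀ i j r t : Fin k, lf i + lf j + lf r ≠ lf t)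
    (hres3 : ∀ i j r t : Fin k, lf i + lf j = lf r + lf t →
      ({i, j} : Finset (Fin k)) = {r, t}) (i j : Fin k) (hij : i ≠ j) :
    Qd lf x aval (lf i + lf j) = ((lf i + lf j : ℕ) : ℝ) * aval * (x (lf i) * x (lf j)) := by
  unfold Qd
  have : ∀ r t : Fin k, aval * x (lf r) * x (lf t) *
      ((if lf r + lf t = lf i + lf j then (lf r : ℝ) else 0)
        + (if lf r = lf i + lf j + lf t then (lf r : ℝ) - lf t else 0))
      = (if r = i then (if t = j then aval * x (lf i) * x (lf j) * lf i else 0) else 0)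
      + (if r = j then (if t = i then aval * x (lf i) * x (lf j) * lf j else 0) else 0) := by
    intro r t
    have hn : ¬ lf r = lf i + lf j + lf t := fun h => hres2 i j t r h.symm
    rw [if_neg hn]
    by_cases h : lf r + lf t = lf i + lf j
    · rw [if_pos h]
      rcases pair_eq (hres3 _ _ _ _ h) with ⟨rfl, rfl⟩ | ⟨rfl, rfl⟩
      · simp [hij]
      · rw [if_neg hij.symm, if_pos rfl, if_pos rfl]; ring
    · rw [if_neg h]
      split_ifs <;> first | (subst_vars; omega) | simp
  simp only [this, Finset.sum_add_distrib]
  simp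
  ring

theorem Qd_sub (hres2 : ∀ i j r t : Fin k, lf i + lf j + lf r ≠ lf t)
    (hres3 : ∀ i j r t : Fin k, lf i + lf j = lf r + lf t →
      ({i, j} : Finset (Fin k)) = {r, t}) (i j : Fin k) (hij : lf j < lf i) :
    Qd lf x aval (lf i - lf j) = ((lf i - lf j : ℕ) : ℝ) * aval * (x (lf i) * x (lf j)) := by
  unfold Qd
  have hne : i ≠ j := by rintro rfl; omega
  have : ∀ r t : Fin k, aval * x (lf r) * x (lf t) *
      ((if lf r + lf t = lf i - lf j then (lf r : ℝ) else 0)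
        + (if lf r = lf i - lf j + lf t then (lf r : ℝ) - lf t else 0))
      = (if r = i then (if t = j then aval * x (lf i) * x (lf j) * (lf i - lf j) else 0) else 0)
      := by
    intro r t
    rw [if_neg (fun h => hres2 r t j i (by omega))]
    by_cases h : lf r = lf i - lf j + lf t
    · rw [if_pos h]
      have h' : lf r + lf j = lf i + lf t := by omega
      rcases pair_eq (hres3 _ _ _ _ h') with ⟨rfl, rfl⟩ | ⟨rfl, rfl⟩
      · simp
      · exact absurd rfl hne
    · rw [if_neg h]
      split_ifs <;> first | (subst_vars; omega) | simp
  simp only [this]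
  simp
  rw [Nat.cast_sub hij.le]
  ring
end

/-- leading order of the non-dominant modes -/
def zh {k : ℕ} (lf : Fin k → ℕ) (a x : ℕ → ℝ) (aval : ℝ) (n : ℕ) : ℝ :=
  open Classical in
  if n = 0 ∨ ∃ i, n = lf i then 0 else Qd lf x aval n / (n * (aval - a n))

theorem zh_nonres {k : ℕ} (lf : Fin k → ℕ) (a x : ℕ → ℝ) (aval : ℝ) (n : ℕ)
    (h1 : 1 ≤ n) (h2 : ∀ i, n ≠ lf i) :
    zh lf a x aval n = Qd lf x aval n / (n * (aval - a n)) := by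
  unfold zh
  rw [if_neg]
  rintro (h | ⟨i, h⟩)
  · omega
  · exact h2 i h

theorem cubic_identity (a : ℕ → ℝ) (aval : ℝ) (hav : 0 < aval) (k : ℕ)
    (lf : Fin k → ℕ) (hl1 : ∀ i, 1 ≤ lf i) (hmono : StrictMono lf)
    (hin : ∀ i, a (lf i) = aval)
    (hout : ∀ j : ℕ, 1 ≤ j → (∀ i, j ≠ lf i) → a j < aval)
    (hres1 : ∀ i j t : Fin k, lf i + lf j ≠ lf t)
    (hres2 : ∀ i j r t : Fin k, lf i + lf j + lf r ≠ lf t)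
    (hres3 : ∀ i j r t : Fin k, lf i + lf j = lf r + lf t →
      ({i, j} : Finset (Fin k)) = {r, t})
    (B : Fin k → Fin k → ℝ)
    (hBd : ∀ i, B i i = (aval - 2 * a (2 * lf i)) / (aval - a (2 * lf i)))
    (hBlt : ∀ i j, i < j → B i j = (2 / (lf i : ℝ)) *
      (((lf j : ℝ) * aval - ((lf i + lf j : ℕ) : ℝ) * a (lf i + lf j))
          / (aval - a (lf i + lf j))
        + (((lf j - lf i : ℕ) : ℝ) * a (lf j - lf i) - (lf j : ℝ) * aval)
          / (aval - a (lf j - lf i))))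
    (hBgt : ∀ i j, j < i → B i j = (2 / (lf i : ℝ)) *
      (((lf j : ℝ) * aval - ((lf i + lf j : ℕ) : ℝ) * a (lf i + lf j))
          / (aval - a (lf i + lf j))
        - (((lf i - lf j : ℕ) : ℝ) * a (lf i - lf j) + (lf j : ℝ) * aval)
          / (aval - a (lf i - lf j))))
    (x : ℕ → ℝ) (i : Fin k) :
    (2 / aval) * ∑ m, x (lf m) * Ec a (zh lf a x aval) (lf i) (lf m)
      = - (lf i : ℝ) * (B i i * x (lf i) ^ 3
          + ∑ j ∈ Finset.univ.erase i, B i j * x (lf i) * x (lf j) ^ 2) := by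
  have hl0 : (0 : ℝ) < lf i := by exact_mod_cast hl1 i
  have hadd : ∀ j : Fin k, 0 < aval - a (lf i + lf j) := fun j =>
    sub_pos.2 (hout _ (by have := hl1 i; omega) (fun t => hres1 i j t))
  have hdiff : ∀ r t : Fin k, lf t < lf r → 0 < aval - a (lf r - lf t) := fun r t h =>
    sub_pos.2 (hout _ (by omega) (fun s hs => hres1 s t r (by omega)))
  have zadd : ∀ j : Fin k, i ≠ j →
      zh lf a x aval (lf i + lf j) = aval * (x (lf i) * x (lf j)) / (aval - a (lf i + lf j)) := by
    intro j hij
    rw [zh_nonres _ _ _ _ _ (by have := hl1 i; omega) (fun t => hres1 i j t),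
      Qd_add lf x aval hres2 hres3 i j hij]
    have : (0 : ℝ) < ((lf i + lf j : ℕ) : ℝ) := by
      have := hl1 i; exact_mod_cast (by omega : 0 < lf i + lf j)
    have := (hadd j).ne'
    field_simp
  have zdbl : zh lf a x aval (lf i + lf i)
      = aval * x (lf i) ^ 2 / (2 * (aval - a (lf i + lf i))) := by
    rw [zh_nonres _ _ _ _ _ (by have := hl1 i; omega) (fun t => hres1 i i t),
      Qd_dbl lf x aval hres2 hres3 i]
    have := (hadd i).ne'
    push_cast
    field_simp
    ring
  have zsub : ∀ r t : Fin k, lf t < lf r →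
      zh lf a x aval (lf r - lf t) = aval * (x (lf r) * x (lf t)) / (aval - a (lf r - lf t)) := by
    intro r t h
    rw [zh_nonres _ _ _ _ _ (by omega) (fun s hs => hres1 s t r (by omega)),
      Qd_sub lf x aval hres2 hres3 r t h]
    have : (0 : ℝ) < ((lf r - lf t : ℕ) : ℝ) := by
      exact_mod_cast (by omega : 0 < lf r - lf t)
    have := (hdiff r t h).ne'
    field_simp
  rw [← Finset.add_sum_erase _ _ (Finset.mem_univ i), mul_add, mul_add]
  congr 1
  · unfold Ec
    simp only [lt_self_iff_false, if_false, zdbl, hBd, hin]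
    have h2 : 2 * lf i = lf i + lf i := by omega
    rw [h2]
    have := (hadd i).ne'
    push_cast
    field_simp
    ring
  · rw [Finset.mul_sum, Finset.mul_sum]
    refine Finset.sum_congr rfl fun j hj => ?_
    have hji : j ≠ i := Finset.ne_of_mem_erase hj
    rcases lt_or_gt_of_ne hji with h | h
    · have hlt := hmono h
      unfold Ec
      rw [if_pos hlt, if_neg (by omega), if_pos hlt, zadd j hji.symm, zsub i j hlt, hBgt i j h,
        hin]
      have h1 := (hadd j).ne'
      have h2 := (hdiff i j hlt).ne'
      generalize a (lf i + lf j) = b1 at *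
      generalize a (lf i - lf j) = b2 at *
      generalize ((lf i - lf j : ℕ) : ℝ) = d at *
      push_cast
      field_simp
      ring
    · have hlt := hmono h
      unfold Ec
      rw [if_neg (by omega), if_pos hlt, if_neg (by omega), zadd j hji.symm, zsub j i hlt,
        hBlt i j h, hin]
      have h1 := (hadd j).ne'
      have h2 := (hdiff j i hlt).ne'
      generalize a (lf i + lf j) = b1 at *
      generalize a (lf j - lf i) = b2 at *
      generalize ((lf j - lf i : ℕ) : ℝ) = d at *
      push_cast
      field_simp
      ring

/-- `x` without its junk value at `0` and the dominant modes -/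
def zp {k : ℕ} (lf : Fin k → ℕ) (x : ℕ → ℝ) (n : ℕ) : ℝ :=
  open Classical in
  if n = 0 ∨ ∃ i, n = lf i then 0 else x n

theorem zp_nonres {k : ℕ} (lf : Fin k → ℕ) (x : ℕ → ℝ) (n : ℕ)
    (h1 : 1 ≤ n) (h2 : ∀ i, n ≠ lf i) : zp lf x n = x n := by
  unfold zp
  rw [if_neg]
  rintro (h | ⟨i, h⟩)
  · omega
  · exact h2 i h

theorem yz_eq {k : ℕ} (lf : Fin k → ℕ) (hl1 : ∀ i, 1 ≤ lf i) (hinj : Function.Injective lf)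
    (x : ℕ → ℝ) (n : ℕ) : yp lf x n + zp lf x n = if n = 0 then 0 else x n := by
  by_cases h0 : n = 0
  · subst h0
    rw [yp_out lf x 0 (fun i => by have := hl1 i; omega)]
    simp [zp]
  · rw [if_neg h0]
    by_cases h : ∃ i, n = lf i
    · obtain ⟨i, rfl⟩ := h
      rw [yp_at lf hinj]
      simp [zp]
    · rw [yp_out lf x n (fun i hi => h ⟨i, hi⟩), zp_nonres lf x n (by omega)
        (fun i hi => h ⟨i, hi⟩), zero_add]

theorem wn_L2b {x : ℕ → ℝ} (hx : MemL2w x) : L2b (fun n => if n = 0 then 0 else x n) (wnorm x) := by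
  refine ⟨Real.sqrt_nonneg _, fun s => ?_⟩
  have hnn : 0 ≤ wnormSq x := tsum_nonneg fun n => by positivity
  unfold wnorm
  rw [Real.sq_sqrt hnn]
  set f : ℕ → ℝ := fun n => (1 + (n : ℝ) ^ 2) * (if n = 0 then 0 else x n) ^ 2 with hf
  have hs : Summable f := by
    rw [← summable_nat_add_iff 1]
    simpa [hf, MemL2w] using hx
  have ht : ∑' n, f n = wnormSq x := by
    rw [hs.tsum_eq_zero_add]
    simp [hf, wnormSq]
  rw [← ht]
  refine le_trans (Finset.sum_le_sum fun n _ => ?_) (hs.sum_le_tsum s fun n _ => ?_)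
  · simp only [hf]
    nlinarith [sq_nonneg (n : ℝ), sq_nonneg (if n = 0 then 0 else x n),
      mul_nonneg (sq_nonneg (n : ℝ)) (sq_nonneg (if n = 0 then 0 else x n))]
  · simp only [hf]; positivity

theorem L2b.mono {u v : ℕ → ℝ} {U : ℝ} (hv : L2b v U) (h : ∀ n, u n ^ 2 ≤ v n ^ 2) : L2b u U :=
  ⟨hv.1, fun s => (Finset.sum_le_sum fun n _ => h n).trans (hv.2 s)⟩

theorem L2b.abs_le {u : ℕ → ℝ} {U : ℝ} (hu : L2b u U) (n : ℕ) : |u n| ≤ U := by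
  have := hu.2 {n}
  rw [Finset.sum_singleton] at this
  exact abs_le_of_sq_le_sq this hu.1

theorem L2b_decay : ∃ S : ℝ, 0 < S ∧ ∀ (u : ℕ → ℝ) (D : ℝ), 0 ≤ D → (∀ n : ℕ, |u n| ≤ D / n) →
    L2b u (D * S) := by
  have hs : Summable fun n : ℕ => 1 / (n : ℝ) ^ 2 := Real.summable_one_div_nat_pow.2 one_lt_two
  have hT : 0 ≤ ∑' n : ℕ, 1 / (n : ℝ) ^ 2 := tsum_nonneg fun n => by positivity
  refine ⟨1 + ∑' n : ℕ, 1 / (n : ℝ) ^ 2, by positivity, fun u D hD h => ⟨by positivity, fun s => ?_⟩⟩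
  have h1 := hs.sum_le_tsum s (fun n _ => by positivity)
  set T := ∑' n : ℕ, 1 / (n : ℝ) ^ 2
  calc ∑ n ∈ s, u n ^ 2 ≤ ∑ n ∈ s, D ^ 2 * (1 / (n : ℝ) ^ 2) := by
        refine Finset.sum_le_sum fun n _ => ?_
        rw [← sq_abs (u n)]
        calc |u n| ^ 2 ≤ (D / n) ^ 2 := pow_le_pow_left₀ (abs_nonneg _) (h n) 2
          _ = _ := by rw [div_pow]; ring
    _ = D ^ 2 * ∑ n ∈ s, 1 / (n : ℝ) ^ 2 := by rw [Finset.mul_sum]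
    _ ≤ D ^ 2 * (1 + T) ^ 2 := by
        refine mul_le_mul_of_nonneg_left ?_ (sq_nonneg _)
        nlinarith
    _ = _ := by ring

theorem Qb_congr {a u u' v v' : ℕ → ℝ} (hu : ∀ n, 1 ≤ n → u n = u' n)
    (hv : ∀ n, 1 ≤ n → v n = v' n) (ℓ : ℕ) : Qb a u v ℓ = Qb a u' v' ℓ := by
  unfold Qb
  congr 1
  · refine Finset.sum_congr rfl fun j hj => ?_
    rw [Finset.mem_Ico] at hj
    rw [hu j hj.1, hv (ℓ - j) (by omega)]
  · refine tsum_congr fun k => ?_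
    unfold tl
    rw [hu _ (by omega), hv _ (by omega)]

set_option maxHeartbeats 2000000 in
/-- the reduced Lyapunov–Schmidt equation in the no-resonance case:
for small solutions near `κ = 2/a`, each dominant mode `l = ℓ_i ∈ Λ` satisfies
`(2 − κa) x_l + B_{ll} x_l³ + ∑_{j∈Λ, j≠l} B_{lj} x_l x_j² = O(‖x‖_w⁴ + ‖x‖_w³|κa−2|)`. -/
theorem reduced_LS_no_resonance
    (a : ℕ → ℝ) (hA : ∃ C : ℝ, ∀ ℓ : ℕ, 1 ≤ ℓ → (ℓ : ℝ) * |a ℓ| ≤ C)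
    (aval : ℝ) (hav : 0 < aval) (k : ℕ) (hk : 1 ≤ k)
    (lf : Fin k → ℕ) (hl1 : ∀ i, 1 ≤ lf i) (hmono : StrictMono lf)
    (hin : ∀ i, a (lf i) = aval)
    (hout : ∀ j : ℕ, 1 ≤ j → (∀ i, j ≠ lf i) → a j < aval)
    (hres1 : ∀ i j t : Fin k, lf i + lf j ≠ lf t)
    (hres2 : ∀ i j r t : Fin k, lf i + lf j + lf r ≠ lf t)
    (hres3 : ∀ i j r t : Fin k, lf i + lf j = lf r + lf t →
      ({i, j} : Finset (Fin k)) = {r, t})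
    (B : Fin k → Fin k → ℝ)
    (hBd : ∀ i, B i i = (aval - 2 * a (2 * lf i)) / (aval - a (2 * lf i)))
    (hBlt : ∀ i j, i < j → B i j = (2 / (lf i : ℝ)) *
      (((lf j : ℝ) * aval - ((lf i + lf j : ℕ) : ℝ) * a (lf i + lf j))
          / (aval - a (lf i + lf j))
        + (((lf j - lf i : ℕ) : ℝ) * a (lf j - lf i) - (lf j : ℝ) * aval)
          / (aval - a (lf j - lf i))))
    (hBgt : ∀ i j, j < i → B i j = (2 / (lf i : ℝ)) *
      (((lf j : ℝ) * aval - ((lf i + lf j : ℕ) : ℝ) * a (lf i + lf j))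
          / (aval - a (lf i + lf j))
        - (((lf i - lf j : ℕ) : ℝ) * a (lf i - lf j) + (lf j : ℝ) * aval)
          / (aval - a (lf i - lf j)))) :
    ∃ η : ℝ, 0 < η ∧ ∃ δ : ℝ, 0 < δ ∧ ∃ C : ℝ, 0 < C ∧
      ∀ κ : ℝ, |κ - 2 / aval| ≤ δ →
        ∀ x : ℕ → ℝ, MemL2w x → wnorm x ≤ η → SolvesMV a κ x →
          ∀ i : Fin k,
            |(2 - κ * aval) * x (lf i) + B i i * x (lf i) ^ 3
                + ∑ j ∈ Finset.univ.erase i, B i j * x (lf i) * x (lf j) ^ 2|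
              ≤ C * (wnorm x ^ 4 + wnorm x ^ 3 * |κ * aval - 2|) := by
  obtain ⟨A0, hA0⟩ := hA
  obtain ⟨A, hApos, hA⟩ : ∃ A : ℝ, 0 < A ∧ ∀ n : ℕ, (n : ℝ) * |a n| ≤ A := by
    refine ⟨|A0| + 1, by positivity, fun n => ?_⟩
    rcases Nat.eq_zero_or_pos n with h | h
    · subst h; simp; positivity
    · linarith [hA0 n h, le_abs_self A0]
  obtain ⟨c, hc, hgap⟩ := gap_exists a hA aval hav (fun j => ∀ i, j ≠ lf i) hout
  obtain ⟨S, hS, hdecay⟩ := L2b_decay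
  have hinj : Function.Injective lf := hmono.injective
  set D2 : ℝ := 18 * A / c * S with hD2
  set D3 : ℝ := 36 * A * D2 / c + 6 * A * aval / c ^ 2 with hD3
  have hD2p : 0 < D2 := by positivity
  have hD3p : 0 < D3 := by positivity
  refine ⟨1, one_pos, min (1 / aval) (c / (2 * aval ^ 2)), by positivity,
    3 / aval * (6 * k * A * D3) + 3 / aval * (3 * A * D2 ^ 2) + 18 * k * A ^ 2 / (aval * c) + 1,
    by positivity, ?_⟩
  intro κ hκ x hx _ hsol i
  set N := wnorm x with hN
  set e := |κ * aval - 2| with he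
  have he0 : 0 ≤ e := abs_nonneg _
  have hκe : |κ - 2 / aval| = e / aval := by
    rw [he, eq_div_iff hav.ne', ← abs_of_pos hav, ← abs_mul, abs_of_pos hav]
    congr 1; field_simp
  have hκ1 := abs_le.1 (hκ.trans (min_le_left _ _))
  have hκlo : 1 / aval ≤ κ := by
    have : 2 / aval = 1 / aval + 1 / aval := by ring
    linarith [hκ1.1]
  have hκhi : κ ≤ 3 / aval := by
    have : 3 / aval = 2 / aval + 1 / aval := by ring
    linarith [hκ1.2]
  have hκpos : 0 < κ := lt_of_lt_of_le (by positivity) hκlo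
  have heb : e ≤ c / (2 * aval) := by
    have h := hκ.trans (min_le_right _ _)
    rw [hκe, div_le_iff₀ hav] at h
    refine h.trans (le_of_eq ?_)
    field_simp
  -- lower bound for the linear part
  have hlow : ∀ p : ℕ, 1 ≤ p → (∀ i, p ≠ lf i) → c / (2 * aval) ≤ 2 - κ * a p := by
    intro p hp hp'
    have h1 := hgap p hp hp'
    have h2 : 1 / aval * c ≤ κ * (aval - a p) := mul_le_mul hκlo h1 hc.le hκpos.le
    have h3 := le_abs_self (κ * aval - 2)
    have h4 : 1 / aval * c = c / (2 * aval) + c / (2 * aval) := by field_simp; ring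
    nlinarith
  have hc2 : 0 < c / (2 * aval) := by positivity
  set y := yp lf x with hy
  set z := zp lf x with hz
  have hX : L2b (fun n => y n + z n) N := by
    have := wn_L2b hx
    convert this using 2 with n
    exact yz_eq lf hl1 hinj x n
  have hXn : ∀ n, 1 ≤ n → y n + z n = x n := by
    intro n hn
    rw [hy, hz, yz_eq lf hl1 hinj x n, if_neg (by omega)]
  have hyL : L2b y N := by
    refine hX.mono fun n => ?_
    by_cases h : ∃ i, n = lf i
    · obtain ⟨i, rfl⟩ := h
      simp [hz, zp]
    · rw [hy, yp_out lf x n (fun i hi => h ⟨i, hi⟩)]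
      rw [zero_pow two_ne_zero]; exact sq_nonneg _
  have hN0 : 0 ≤ N := hX.1
  -- the equation
  have heq : ∀ p : ℕ, 1 ≤ p →
      (p : ℝ) * (2 - κ * a p) * x p = κ * Qb a (fun n => y n + z n) (fun n => y n + z n) p := by
    intro p hp
    rw [(hsol p hp).2, ← mul_add, Qb_congr (u' := x) (v' := x) hXn hXn]
    rfl
  have hformula : ∀ p : ℕ, 1 ≤ p → (∀ i, p ≠ lf i) →
      x p = κ * Qb a (fun n => y n + z n) (fun n => y n + z n) p / (p * (2 - κ * a p)) := by
    intro p hp hp'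
    have h0 : (0 : ℝ) < p := by exact_mod_cast hp
    have h1 : 0 < 2 - κ * a p := hc2.trans_le (hlow p hp hp')
    rw [← heq p hp]
    field_simp
  -- decay of z
  have hzdec : ∀ n : ℕ, |z n| ≤ (18 * A / c * N ^ 2) / n := by
    intro n
    by_cases h : n = 0 ∨ ∃ i, n = lf i
    · have : z n = 0 := by rw [hz]; unfold zp; rw [if_pos h]
      rw [this, abs_zero]; positivity
    · have hn1 : 1 ≤ n := by rcases Nat.eq_zero_or_pos n with h' | h'; exact absurd (Or.inl h') h; exact h'
      have hn2 : ∀ i, n ≠ lf i := fun i hi => h (Or.inr ⟨i, hi⟩)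
      have h0 : (0 : ℝ) < n := by exact_mod_cast hn1
      have h1 : 0 < 2 - κ * a n := hc2.trans_le (hlow n hn1 hn2)
      rw [hz, zp_nonres lf x n hn1 hn2, hformula n hn1 hn2, abs_div, abs_mul, abs_of_pos hκpos,
        abs_of_pos (mul_pos h0 h1)]
      calc _ ≤ (3 / aval * (3 * A * (N * N))) / (n * (c / (2 * aval))) := by
            have hq := Qb_bound hA hX hX n
            have hl := hlow n hn1 hn2
            gcongr
        _ = _ := by field_simp; ring
  have hzL : L2b z (D2 * N ^ 2) := by
    have := hdecay z _ (by positivity) hzdec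
    convert this using 1
    rw [hD2]; ring
  -- splitting of the quadratic form
  have hsplit : ∀ p, Qb a (fun n => y n + z n) (fun n => y n + z n) p
      = Qb a y y p + (Qb a y z p + Qb a z (fun n => y n + z n) p) := by
    intro p
    rw [Qb_add_left hA hyL hzL hX, Qb_add_right hA hyL hyL hzL]
    ring
  have hQyy : ∀ p, Qb a y y p = Qd lf x aval p := fun p => Qyy hA lf hl1 hin x hyL p
  have hzhb : ∀ n, |zh lf a x aval n| ≤ 3 * A * (N * N) / c := by
    intro n
    by_cases h : n = 0 ∨ ∃ i, n = lf i
    · have : zh lf a x aval n = 0 := by unfold zh; rw [if_pos h]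
      rw [this, abs_zero]; positivity
    · have hn1 : 1 ≤ n := by rcases Nat.eq_zero_or_pos n with h' | h'; exact absurd (Or.inl h') h; exact h'
      have hn2 : ∀ i, n ≠ lf i := fun i hi => h (Or.inr ⟨i, hi⟩)
      have h0 : (1 : ℝ) ≤ n := by exact_mod_cast hn1
      have hg := hgap n hn1 hn2
      rw [zh_nonres lf a x aval n hn1 hn2, ← hQyy, abs_div,
        abs_of_pos (mul_pos (by linarith) (by linarith) : (0 : ℝ) < n * (aval - a n))]
      have hq := Qb_bound hA hyL hyL n
      have : c ≤ n * (aval - a n) := by nlinarith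
      gcongr
  have hwb : ∀ n, |z n - zh lf a x aval n| ≤ D3 * (N ^ 3 + N ^ 2 * e) := by
    intro n
    by_cases h : n = 0 ∨ ∃ i, n = lf i
    · have h1 : zh lf a x aval n = 0 := by unfold zh; rw [if_pos h]
      have h2 : z n = 0 := by rw [hz]; unfold zp; rw [if_pos h]
      rw [h1, h2, sub_zero, abs_zero]; positivity
    · have hn1 : 1 ≤ n := by rcases Nat.eq_zero_or_pos n with h' | h'; exact absurd (Or.inl h') h; exact h'
      have hn2 : ∀ i, n ≠ lf i := fun i hi => h (Or.inr ⟨i, hi⟩)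
      have h0 : (1 : ℝ) ≤ n := by exact_mod_cast hn1
      have hn0 : (0 : ℝ) < n := by linarith
      have hg := hgap n hn1 hn2
      have hg0 : 0 < aval - a n := by linarith
      have hl := hlow n hn1 hn2
      have h1 : 0 < 2 - κ * a n := hc2.trans_le hl
      have hq := Qb_bound hA hyL hyL n
      have hq1 := Qb_bound hA hyL hzL n
      have hq2 := Qb_bound hA hzL hX n
      rw [hz, zp_nonres lf x n hn1 hn2, zh_nonres lf a x aval n hn1 hn2,
        hformula n hn1 hn2, hsplit, ← hQyy]
      generalize Qb a y y n = q at *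
      have hr : |Qb a y z n + Qb a z (fun n => y n + z n) n| ≤ 6 * A * D2 * N ^ 3 := by
        refine (abs_add_le _ _).trans ((add_le_add hq1 hq2).trans (le_of_eq ?_))
        ring
      generalize Qb a y z n + Qb a z (fun n => y n + z n) n = r at *
      have hid : κ * (q + r) / (n * (2 - κ * a n)) - q / (n * (aval - a n))
          = κ * r / (n * (2 - κ * a n))
            + q * (κ * aval - 2) / (n * (2 - κ * a n) * (aval - a n)) := by
        have e1 := hn0.ne'
        have e2 := h1.ne'
        have e3 := hg0.ne'
        field_simp
        ring
      rw [hid]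
      have hden : c / (2 * aval) ≤ n * (2 - κ * a n) := by nlinarith
      have hden0 : 0 < n * (2 - κ * a n) := by positivity
      have b1 : |κ * r / (n * (2 - κ * a n))|
          ≤ 3 / aval * (6 * A * D2 * N ^ 3) / (c / (2 * aval)) := by
        rw [abs_div, abs_mul, abs_of_pos hκpos, abs_of_pos hden0]
        gcongr
      have b2 : |q * (κ * aval - 2) / (n * (2 - κ * a n) * (aval - a n))|
          ≤ 3 * A * (N * N) * e / (c / (2 * aval) * c) := by
        rw [abs_div, abs_mul, ← he, abs_of_pos (mul_pos hden0 hg0)]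
        gcongr
      have c1 : 3 / aval * (6 * A * D2 * N ^ 3) / (c / (2 * aval)) = 36 * A * D2 / c * N ^ 3 := by
        field_simp; ring
      have c2 : 3 * A * (N * N) * e / (c / (2 * aval) * c)
          = 6 * A * aval / c ^ 2 * (N ^ 2 * e) := by
        field_simp; ring
      rw [c1] at b1
      rw [c2] at b2
      have p1 : 0 ≤ 36 * A * D2 / c * (N ^ 2 * e) := by positivity
      have p2 : 0 ≤ 6 * A * aval / c ^ 2 * N ^ 3 := by positivity
      refine (abs_add_le _ _).trans ((add_le_add b1 b2).trans ?_)
      rw [hD3, add_mul, mul_add, mul_add]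
      linarith
  -- the dominant equation
  have hl0 : (1 : ℝ) ≤ lf i := by exact_mod_cast hl1 i
  have hdom : (lf i : ℝ) * (2 - κ * aval) * x (lf i)
      = κ * (∑ m, x (lf m) * Ec a z (lf i) (lf m) + Qb a z z (lf i)) := by
    have h := heq (lf i) (hl1 i)
    rw [hin] at h
    rw [h, hsplit, Qb_add_right hA hzL hyL hzL, hQyy, Qd_dom lf x aval hres1]
    have h1 : Qb a y z (lf i) = ∑ m, x (lf m) * Qb a (ev (lf m)) z (lf i) :=
      Qb_sum_left hA hzL (fun m => x (lf m)) lf (lf i)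
    have h2 : Qb a z y (lf i) = ∑ m, x (lf m) * Qb a z (ev (lf m)) (lf i) :=
      Qb_sum_right hA hzL (fun m => x (lf m)) lf (lf i)
    rw [h1, h2]
    have h3 : ∀ m, x (lf m) * Ec a z (lf i) (lf m) = x (lf m) * Qb a (ev (lf m)) z (lf i)
        + x (lf m) * Qb a z (ev (lf m)) (lf i) := by
      intro m
      rw [Qb_ev_left _ _ _ _ (hl1 m), Qb_ev_right _ _ _ _ (hl1 m)]
      unfold Ec
      ring
    simp only [h3, Finset.sum_add_distrib]
    ring
  have hxm : ∀ m, |x (lf m)| ≤ N := by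
    intro m
    have := hX.abs_le (lf m)
    rwa [hXn _ (hl1 m)] at this
  have hsumb : ∀ (w : ℕ → ℝ) (D : ℝ), (∀ n, |w n| ≤ D) →
      |∑ m, x (lf m) * Ec a w (lf i) (lf m)| ≤ k * (N * (6 * (A * D))) := by
    intro w D hw
    refine (Finset.abs_sum_le_sum_abs _ _).trans ?_
    calc _ ≤ ∑ _m : Fin k, N * (6 * (A * D)) := by
          refine Finset.sum_le_sum fun m _ => ?_
          rw [abs_mul]
          exact mul_le_mul (hxm m) (Ec_bound hA hw _ _) (abs_nonneg _) hN0
      _ = _ := by simp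
  have hcub := cubic_identity a aval hav k lf hl1 hmono hin hout hres1 hres2 hres3 B hBd hBlt hBgt
    x i
  have hs1 := hsumb _ _ hwb
  have hs2 := hsumb _ _ hzhb
  have hzz := Qb_bound hA hzL hzL (lf i)
  have hsub : ∑ m, x (lf m) * Ec a (fun n => z n - zh lf a x aval n) (lf i) (lf m)
      = ∑ m, x (lf m) * Ec a z (lf i) (lf m)
        - ∑ m, x (lf m) * Ec a (zh lf a x aval) (lf i) (lf m) := by
    rw [← Finset.sum_sub_distrib]
    exact Finset.sum_congr rfl fun m _ => by rw [Ec_sub]; ring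
  rw [hsub] at hs1
  generalize ∑ m, x (lf m) * Ec a z (lf i) (lf m) = Gz at *
  generalize ∑ m, x (lf m) * Ec a (zh lf a x aval) (lf i) (lf m) = Gh at *
  generalize Qb a z z (lf i) = q at *
  rw [add_assoc]
  generalize B i i * x (lf i) ^ 3
    + ∑ j ∈ Finset.univ.erase i, B i j * x (lf i) * x (lf j) ^ 2 = R at *
  have hmain : (lf i : ℝ) * ((2 - κ * aval) * x (lf i) + R)
      = κ * (Gz - Gh) + κ * q + (κ - 2 / aval) * Gh := by
    linear_combination hdom + hcub
  have b1 : |κ * (Gz - Gh)| ≤ 3 / aval * (k * (N * (6 * (A * (D3 * (N ^ 3 + N ^ 2 * e)))))) := by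
    rw [abs_mul, abs_of_pos hκpos]; gcongr
  have b2 : |κ * q| ≤ 3 / aval * (3 * A * (D2 * N ^ 2 * (D2 * N ^ 2))) := by
    rw [abs_mul, abs_of_pos hκpos]; gcongr
  have b3 : |(κ - 2 / aval) * Gh| ≤ e / aval * (k * (N * (6 * (A * (3 * A * (N * N) / c))))) := by
    rw [abs_mul, hκe]; gcongr
  have htot : |(lf i : ℝ) * ((2 - κ * aval) * x (lf i) + R)|
      ≤ 3 / aval * (k * (N * (6 * (A * (D3 * (N ^ 3 + N ^ 2 * e))))))
        + 3 / aval * (3 * A * (D2 * N ^ 2 * (D2 * N ^ 2)))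
        + e / aval * (k * (N * (6 * (A * (3 * A * (N * N) / c))))) := by
    rw [hmain]
    exact (abs_add_le _ _).trans (add_le_add ((abs_add_le _ _).trans (add_le_add b1 b2)) b3)
  rw [abs_mul, Nat.abs_cast] at htot
  have hle : |(2 - κ * aval) * x (lf i) + R| ≤ (lf i : ℝ) * |(2 - κ * aval) * x (lf i) + R| :=
    le_mul_of_one_le_left (abs_nonneg _) hl0
  refine hle.trans (htot.trans ?_)
  have e1 : 3 / aval * (k * (N * (6 * (A * (D3 * (N ^ 3 + N ^ 2 * e))))))
      = 3 / aval * (6 * k * A * D3) * (N ^ 4 + N ^ 3 * e) := by ring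
  have e2 : 3 / aval * (3 * A * (D2 * N ^ 2 * (D2 * N ^ 2)))
      = 3 / aval * (3 * A * D2 ^ 2) * N ^ 4 := by ring
  have e3 : e / aval * (k * (N * (6 * (A * (3 * A * (N * N) / c)))))
      = 18 * k * A ^ 2 / (aval * c) * (N ^ 3 * e) := by field_simp; ring
  rw [e1, e2, e3, add_mul, add_mul, add_mul]
  have p4 : 0 ≤ N ^ 4 := by positivity
  have p3 : 0 ≤ N ^ 3 * e := by positivity
  have q2 : 3 / aval * (3 * A * D2 ^ 2) * N ^ 4
      ≤ 3 / aval * (3 * A * D2 ^ 2) * (N ^ 4 + N ^ 3 * e) :=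
    mul_le_mul_of_nonneg_left (by linarith) (by positivity)
  have q3 : 18 * k * A ^ 2 / (aval * c) * (N ^ 3 * e)
      ≤ 18 * k * A ^ 2 / (aval * c) * (N ^ 4 + N ^ 3 * e) :=
    mul_le_mul_of_nonneg_left (by linarith) (by positivity)
  linarith
end
end
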